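/- Let V : ℝ² → ℝ be a harmonic function on all of ℝ². Then every maximal solution of the system ẍ(t) = -V_x(x(t),y(t)), ÿ(t) = +V_y(x(t),y(t)) is defined on all of ℝ if and only if V is a polynomial of degree at most 2 (equivalently V_xxx ≡ 0 and V_yyy ≡ 0). -/

import Mathlib

open Set

noncomputable section

/-- `q` (with velocity `v`) solves the second-order planar ODE
`q̈(t) = F (q(t))` on the set `s`. -/
def SolOn (F : ℝ × ℝ → ℝ × ℝ) (q v : ℝ → ℝ × ℝ) (s : Set ℝ) : Prop :=
  ∀ t ∈ s, HasDerivAt q (v t) t ∧ HasDerivAt v (F (q t)) t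

/-- `q` (with velocity `v`) is a maximal solution of `q̈(t) = F (q(t))` on
the open interval `s`. -/
def IsMaximalSolution (F : ℝ × ℝ → ℝ × ℝ) (q v : ℝ → ℝ × ℝ) (s : Set ℝ) : Prop :=
  IsOpen s ∧ s.OrdConnected ∧ s.Nonempty ∧ SolOn F q v s ∧
  ∀ (s' : Set ℝ) (q' v' : ℝ → ℝ × ℝ), IsOpen s' → s'.OrdConnected → s ⊆ s' →
    SolOn F q' v' s' → (∀ t ∈ s, q' t = q t ∧ v' t = v t) → s' = s

namespace HolomorphicFlow

open Topology

section Flow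

variable {E : Type*} [NormedAddCommGroup E] [NormedSpace ℂ E]

/-- `γ` is the solution of `γ' = c • X γ` on `[0, 1]` issued from `p`. Its value at time `1` is the
complex time `c` flow of `X`, reached along a straight ray. -/
structure IsRay (X : E → E) (c : ℂ) (p : E) (γ : ℝ → E) : Prop where
  zero : γ 0 = p
  deriv : ∀ s ∈ Icc (0 : ℝ) 1, HasDerivWithinAt γ (c • X (γ s)) (Icc 0 1) s

/-- The pairs `(c, p)` such that the flow of `X` issued from `p` exists up to the complex time
`c`. -/
def flowDomain (X : E → E) : Set (ℂ × E) := {x | ∃ γ, IsRay X x.1 x.2 γ}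

open Classical in
/-- The flow of `X` at complex time `x.1` issued from `x.2`. -/
def flow (X : E → E) (x : ℂ × E) : E :=
  if h : ∃ γ, IsRay X x.1 x.2 γ then h.choose 1 else 0

variable {X : E → E} {c : ℂ} {p : E} {γ γ₁ γ₂ : ℝ → E}

theorem IsRay.continuousOn (h : IsRay X c p γ) : ContinuousOn γ (Icc 0 1) :=
  fun s hs => (h.deriv s hs).continuousWithinAt

theorem IsRay.eqOn (hX : ContDiff ℂ 1 X) (h₁ : IsRay X c p γ₁) (h₂ : IsRay X c p γ₂) :
    EqOn γ₁ γ₂ (Icc 0 1) := by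
  have hX' : LocallyLipschitz (fun x => c • X x) := by
    have : ContDiff ℝ 1 (fun x => c • X x) := (hX.const_smul c).restrict_scalars ℝ
    exact this.locallyLipschitz
  have hK : IsCompact (γ₁ '' Icc 0 1 ∪ γ₂ '' Icc 0 1) :=
    (isCompact_Icc.image_of_continuousOn h₁.continuousOn).union
      (isCompact_Icc.image_of_continuousOn h₂.continuousOn)
  obtain ⟨K, hK⟩ := (hX'.locallyLipschitzOn (s := _)).exists_lipschitzOnWith_of_compact hK
  have key : ∀ γ, IsRay X c p γ → ∀ t ∈ Ico (0 : ℝ) 1,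
      HasDerivWithinAt γ (c • X (γ t)) (Ici t) t := by
    intro γ h t ht
    refine (h.deriv t ⟨ht.1, ht.2.le⟩).mono_of_mem_nhdsWithin ?_
    exact Filter.mem_of_superset (Icc_mem_nhdsGE ht.2) (Icc_subset_Icc_left ht.1)
  exact ODE_solution_unique_of_mem_Icc_right (v := fun _ x => c • X x) (fun _ _ => hK)
    h₁.continuousOn (key _ h₁) (fun t ht => Or.inl ⟨t, ⟨ht.1, ht.2.le⟩, rfl⟩)
    h₂.continuousOn (key _ h₂) (fun t ht => Or.inr ⟨t, ⟨ht.1, ht.2.le⟩, rfl⟩)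
    (h₁.zero.trans h₂.zero.symm)

theorem IsRay.mem (h : IsRay X c p γ) : (c, p) ∈ flowDomain X := ⟨γ, h⟩

theorem IsRay.flow_eq (hX : ContDiff ℂ 1 X) (h : IsRay X c p γ) : flow X (c, p) = γ 1 := by
  have h' : ∃ γ, IsRay X c p γ := ⟨γ, h⟩
  rw [flow, dif_pos h']
  exact h'.choose_spec.eqOn hX h ⟨zero_le_one, le_rfl⟩

theorem IsRay.scale (h : IsRay X c p γ) {l : ℝ} (hl : l ∈ Icc (0 : ℝ) 1) :
    IsRay X (l * c) p (fun s => γ (l * s)) := by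
  refine ⟨by simp [h.zero], fun s hs => ?_⟩
  have hm : MapsTo (fun s : ℝ => l * s) (Icc 0 1) (Icc 0 1) := fun s hs =>
    ⟨mul_nonneg hl.1 hs.1, mul_le_one₀ hl.2 hs.1 hs.2⟩
  have h1 : HasDerivWithinAt (fun s : ℝ => l * s) l (Icc 0 1) s := by
    simpa using ((hasDerivAt_id s).const_mul l).hasDerivWithinAt
  have := (h.deriv _ (hm hs)).scomp s h1 hm
  convert! this using 1
  rw [mul_smul, Complex.coe_smul]

theorem IsRay.flow_scale (hX : ContDiff ℂ 1 X) (h : IsRay X c p γ) {l : ℝ}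
    (hl : l ∈ Icc (0 : ℝ) 1) : flow X (l * c, p) = γ l := by
  simpa using (h.scale hl).flow_eq hX

theorem flowDomain_scale (h : (c, p) ∈ flowDomain X) {l : ℝ} (hl : l ∈ Icc (0 : ℝ) 1) :
    ((l : ℂ) * c, p) ∈ flowDomain X := by
  obtain ⟨γ, hγ⟩ := h
  exact (hγ.scale hl).mem

theorem isRay_zero : IsRay X 0 p (fun _ => p) :=
  ⟨rfl, fun s _ => by simpa using hasDerivWithinAt_const s _ p⟩

theorem zero_mem_flowDomain : ((0 : ℂ), p) ∈ flowDomain X := isRay_zero.mem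

theorem flow_zero (hX : ContDiff ℂ 1 X) : flow X (0, p) = p := isRay_zero.flow_eq hX

/-- A curve which solves the equation along a segment of complex times computes the flow. -/
theorem isRay_of_hasDerivAt {Z : ℂ → E} {t : ℂ}
    (hZ : ∀ l ∈ Icc (0 : ℝ) 1, HasDerivAt Z (X (Z (t + l * c))) (t + l * c)) :
    IsRay X c (Z t) (fun l : ℝ => Z (t + l * c)) := by
  refine ⟨by simp, fun s hs => HasDerivAt.hasDerivWithinAt ?_⟩
  have h1 : HasDerivAt (fun l : ℝ => t + (l : ℂ) * c) c s := by
    simpa using ((Complex.ofRealCLM.hasDerivAt (x := s)).mul_const c).const_add t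
  exact (hZ s hs).scomp s h1

theorem isRay_of_hasDerivAt_segment {Z : ℝ → E} {t a : ℝ}
    (hZ : ∀ s ∈ Icc (0 : ℝ) 1, HasDerivAt Z (X (Z (t + s * a))) (t + s * a)) :
    IsRay X (a : ℂ) (Z t) (fun l : ℝ => Z (t + l * a)) := by
  refine ⟨by simp, fun s hs => HasDerivAt.hasDerivWithinAt ?_⟩
  have h1 : HasDerivAt (fun l : ℝ => t + l * a) a s := by
    simpa using ((hasDerivAt_id s).mul_const a).const_add t
  have := (hZ s hs).scomp s h1
  rwa [← Complex.coe_smul] at this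

theorem isRay_of_hasDerivAt_real {Z : ℝ → E} {t a : ℝ}
    (hZ : ∀ s, HasDerivAt Z (X (Z s)) s) :
    IsRay X (a : ℂ) (Z t) (fun l : ℝ => Z (t + l * a)) :=
  isRay_of_hasDerivAt_segment fun _ _ => hZ _

/-- Concatenation of two pieces of a ray. -/
theorem IsRay.trans {l : ℝ} (hl : l ∈ Ioo (0 : ℝ) 1) (h₁ : IsRay X (l * c) p γ₁)
    (h₂ : IsRay X ((1 - l : ℝ) * c) (γ₁ 1) γ₂) :
    IsRay X c p (fun s => if s ≤ l then γ₁ (s / l) else γ₂ ((s - l) / (1 - l))) := by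
  have hl0 : 0 < l := hl.1
  have hl1 : 0 < 1 - l := by linarith [hl.2]
  set γ : ℝ → E := fun s => if s ≤ l then γ₁ (s / l) else γ₂ ((s - l) / (1 - l)) with hγ
  have e₁ : ∀ s ∈ Icc 0 l, γ s = γ₁ (s / l) := fun s hs => if_pos hs.2
  have e₂ : ∀ s ∈ Icc l 1, γ s = γ₂ ((s - l) / (1 - l)) := by
    intro s hs
    rcases hs.1.eq_or_lt with rfl | h
    · simp [hγ, hl0.ne', h₂.zero]
    · exact if_neg h.not_ge
  have m₁ : MapsTo (fun s => s / l) (Icc 0 l) (Icc 0 1) := fun s hs =>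
    ⟨div_nonneg hs.1 hl0.le, (div_le_one hl0).2 hs.2⟩
  have m₂ : MapsTo (fun s => (s - l) / (1 - l)) (Icc l 1) (Icc 0 1) := fun s hs =>
    ⟨div_nonneg (sub_nonneg.2 hs.1) hl1.le, (div_le_one hl1).2 (by linarith [hs.2])⟩
  have d₁ : ∀ s ∈ Icc 0 l, HasDerivWithinAt γ (c • X (γ s)) (Icc 0 l) s := by
    intro s hs
    have h : HasDerivWithinAt (fun s : ℝ => s / l) (1 / l) (Icc 0 l) s :=
      ((hasDerivAt_id s).div_const l).hasDerivWithinAt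
    have := ((h₁.deriv _ (m₁ hs)).scomp s h m₁).congr e₁ (e₁ s hs)
    convert! this using 1
    rw [e₁ s hs, ← Complex.coe_smul, smul_smul]
    congr 1
    push_cast
    have : (l : ℂ) ≠ 0 := by exact_mod_cast hl0.ne'
    field_simp
  have d₂ : ∀ s ∈ Icc l 1, HasDerivWithinAt γ (c • X (γ s)) (Icc l 1) s := by
    intro s hs
    have h : HasDerivWithinAt (fun s : ℝ => (s - l) / (1 - l)) (1 / (1 - l)) (Icc l 1) s :=
      (((hasDerivAt_id s).sub_const l).div_const (1 - l)).hasDerivWithinAt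
    have := ((h₂.deriv _ (m₂ hs)).scomp s h m₂).congr e₂ (e₂ s hs)
    convert! this using 1
    rw [e₂ s hs, ← Complex.coe_smul, smul_smul]
    congr 1
    have : ((1 - l : ℝ) : ℂ) ≠ 0 := by exact_mod_cast hl1.ne'
    push_cast at this ⊢
    field_simp
  refine ⟨by rw [e₁ 0 ⟨le_rfl, hl0.le⟩]; simpa using h₁.zero, fun s hs => ?_⟩
  rw [← Icc_union_Icc_eq_Icc hl.1.le hl.2.le]
  rcases lt_trichotomy s l with h | rfl | h
  · refine (d₁ s ⟨hs.1, h.le⟩).union (hasDerivWithinAt_iff_hasFDerivWithinAt.2 (.of_notMem_closure ?_))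
    rw [closure_Icc]; exact fun h' => h.not_ge h'.1
  · exact (d₁ s ⟨hs.1, le_rfl⟩).union (d₂ s ⟨le_rfl, hs.2⟩)
  · refine HasDerivWithinAt.union (hasDerivWithinAt_iff_hasFDerivWithinAt.2 (.of_notMem_closure ?_)) (d₂ s ⟨h.le, hs.2⟩)
    rw [closure_Icc]; exact fun h' => h.not_ge h'.2

theorem flow_trans (hX : ContDiff ℂ 1 X) {l : ℝ} (hl : l ∈ Ioo (0 : ℝ) 1)
    (h₁ : ((l : ℂ) * c, p) ∈ flowDomain X)
    (h₂ : (((1 - l : ℝ) : ℂ) * c, flow X (l * c, p)) ∈ flowDomain X) :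
    (c, p) ∈ flowDomain X ∧
      flow X (c, p) = flow X (((1 - l : ℝ) : ℂ) * c, flow X (l * c, p)) := by
  obtain ⟨γ₁, h₁⟩ := h₁
  obtain ⟨γ₂, h₂⟩ := h₂
  have e := h₁.flow_eq hX
  simp only at h₁ h₂
  have h₂' := h₂.flow_eq hX
  rw [e] at h₂
  have h := h₁.trans hl h₂
  refine ⟨h.mem, ?_⟩
  rw [h₂', h.flow_eq hX, if_neg hl.2.not_ge, div_self (by linarith [hl.2])]

/-- Pointwise application of a path of operators to a path of vectors. -/
def pathApply (E : Type*) [NormedAddCommGroup E] [NormedSpace ℂ E] :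
    C(Icc (0 : ℝ) 1, E →L[ℂ] E) →L[ℂ] C(Icc (0 : ℝ) 1, E) →L[ℂ] C(Icc (0 : ℝ) 1, E) :=
  LinearMap.mkContinuous₂
    (LinearMap.mk₂ ℂ (fun (A : C(Icc (0 : ℝ) 1, E →L[ℂ] E)) (δ : C(Icc (0 : ℝ) 1, E)) =>
        (⟨fun s => A s (δ s), by fun_prop⟩ : C(Icc (0 : ℝ) 1, E)))
      (fun _ _ _ => by ext; simp) (fun _ _ _ => by ext; simp)
      (fun _ _ _ => by ext; simp) (fun _ _ _ => by ext; simp)) 1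
    (fun A δ => by
      rw [one_mul]
      refine (ContinuousMap.norm_le _ (by positivity)).2 fun s => ?_
      exact (A s).le_of_opNorm_le_of_le (A.norm_coe_le_norm s) (δ.norm_coe_le_norm s))

/-- Post-composition with a `C¹` map is `C¹` on the space of paths. -/
theorem contDiff_postcomp (hX : ContDiff ℂ 1 X) :
    ContDiff ℂ 1 (fun γ : C(Icc (0 : ℝ) 1, E) => (⟨X, hX.continuous⟩ : C(E, E)).comp γ) := by
  have hD : Continuous (fderiv ℂ X) := hX.continuous_fderiv one_ne_zero
  have hDc : Continuous fun γ : C(Icc (0 : ℝ) 1, E) =>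
      (⟨fderiv ℂ X, hD⟩ : C(E, E →L[ℂ] E)).comp γ :=
    ContinuousMap.continuous_postcomp _
  refine contDiff_one_iff_hasFDerivAt.2 ⟨fun γ => pathApply E
    ((⟨fderiv ℂ X, hD⟩ : C(E, E →L[ℂ] E)).comp γ), (pathApply E).continuous.comp hDc, fun γ => ?_⟩
  rw [hasFDerivAt_iff_isLittleO_nhds_zero, Asymptotics.isLittleO_iff]
  intro ε hε
  obtain ⟨η, hη, h⟩ := (Metric.continuousAt_iff (α := C(Icc (0 : ℝ) 1, E))
    (β := C(Icc (0 : ℝ) 1, E →L[ℂ] E))).1 (hDc.continuousAt (x := γ)) ε hε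
  filter_upwards [Metric.ball_mem_nhds (0 : C(Icc (0 : ℝ) 1, E)) hη] with δ hδ
  refine (ContinuousMap.norm_le _ (by positivity)).2 fun s => ?_
  have hs : ‖δ s‖ < η := (δ.norm_coe_le_norm s).trans_lt (by simpa using hδ)
  have key : ∀ x ∈ Metric.ball (γ s) η, ‖fderiv ℂ X x - fderiv ℂ X (γ s)‖ ≤ ε := by
    intro x hx
    have h1 : dist (γ + ContinuousMap.const _ (x - γ s)) γ < η := by
      rw [dist_eq_norm, add_sub_cancel_left]
      refine lt_of_le_of_lt ((ContinuousMap.norm_le _ (norm_nonneg (x - γ s))).2 fun _ => le_rfl) ?_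
      rwa [mem_ball_iff_norm] at hx
    have h2 := (ContinuousMap.dist_apply_le_dist s).trans (h h1).le
    rw [dist_eq_norm] at h2
    simpa using h2
  have := (convex_ball (γ s) η).norm_image_sub_le_of_norm_fderiv_le'
    (fun x _ => hX.differentiable one_ne_zero x) key (Metric.mem_ball_self hη)
    (y := γ s + δ s) (by simpa using hs)
  rw [add_sub_cancel_left] at this
  exact this.trans (by gcongr; exact δ.norm_coe_le_norm s)

/-- The primitive of a path vanishing at `0`. -/
def pathPrimitive (E : Type*) [NormedAddCommGroup E] [NormedSpace ℂ E] :
    C(Icc (0 : ℝ) 1, E) →L[ℂ] C(Icc (0 : ℝ) 1, E) :=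
  have hi (β : C(Icc (0 : ℝ) 1, E)) : Continuous fun t : ℝ => β (projIcc 0 1 zero_le_one t) := by
    fun_prop
  LinearMap.mkContinuous
    { toFun := fun β => ⟨fun s => ∫ t in (0 : ℝ)..s, β (projIcc 0 1 zero_le_one t),
        (intervalIntegral.continuous_primitive
          (fun a b => (hi β).intervalIntegrable a b) 0).comp continuous_subtype_val⟩
      map_add' := fun β β' => by
        ext s
        exact intervalIntegral.integral_add ((hi β).intervalIntegrable _ _)
          ((hi β').intervalIntegrable _ _)
      map_smul' := fun a β => by
        ext s
        exact intervalIntegral.integral_smul a _ }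
    1 (fun β => by
      rw [one_mul]
      refine (ContinuousMap.norm_le _ (norm_nonneg _)).2 fun s => ?_
      have := intervalIntegral.norm_integral_le_of_norm_le_const (a := 0) (b := (s : ℝ))
        (f := fun t => β (projIcc 0 1 zero_le_one t)) (C := ‖β‖) (fun t _ => β.norm_coe_le_norm _)
      refine this.trans (mul_le_of_le_one_right (norm_nonneg _) ?_)
      rw [sub_zero, abs_of_nonneg s.2.1]
      exact s.2.2)

theorem pathPrimitive_apply (β : C(Icc (0 : ℝ) 1, E)) (s : Icc (0 : ℝ) 1) :
    pathPrimitive E β s = ∫ t in (0 : ℝ)..s, β (projIcc 0 1 zero_le_one t) := rfl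

theorem isRay_of_integral_eq [CompleteSpace E] (hX : ContDiff ℂ 1 X) {γ : C(Icc (0 : ℝ) 1, E)}
    (h : γ = ContinuousMap.const _ p +
      c • pathPrimitive E ((⟨X, hX.continuous⟩ : C(E, E)).comp γ)) :
    IsRay X c p (fun s => γ (projIcc 0 1 zero_le_one s)) := by
  have h1 : ∀ s ∈ Icc (0 : ℝ) 1, γ (projIcc 0 1 zero_le_one s) =
      p + c • ∫ t in (0 : ℝ)..s, X (γ (projIcc 0 1 zero_le_one t)) := by
    intro s hs
    conv_lhs => rw [h]
    simp [pathPrimitive_apply, projIcc_of_mem _ hs]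
  have hc : Continuous fun t : ℝ => X (γ (projIcc 0 1 zero_le_one t)) :=
    hX.continuous.comp (γ.continuous.comp continuous_projIcc)
  refine ⟨by simpa using h1 0 (by simp), fun s hs => ?_⟩
  refine HasDerivWithinAt.congr (f := fun s => p + c • ∫ t in (0 : ℝ)..s,
    X (γ (projIcc 0 1 zero_le_one t))) ?_ h1 (h1 s hs)
  have := intervalIntegral.integral_hasDerivAt_right (hc.intervalIntegrable 0 s)
    hc.stronglyMeasurable.stronglyMeasurableAtFilter hc.continuousAt
  exact ((this.const_smul c).const_add p).hasDerivWithinAt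

/-- The set of points near which the flow exists and is holomorphic. -/
def regularSet (X : E → E) : Set (ℂ × E) :=
  {x | ∀ᶠ y in 𝓝 x, y ∈ flowDomain X ∧ DifferentiableAt ℂ (flow X) y}

theorem isOpen_regularSet : IsOpen (regularSet X) := isOpen_setOfPred_eventually_nhds

theorem zero_mem_regularSet [CompleteSpace E] (hX : ContDiff ℂ 1 X) (q : E) :
    ((0 : ℂ), q) ∈ regularSet X := by
  let N : C(Icc (0 : ℝ) 1, E) → C(Icc (0 : ℝ) 1, E) :=
    fun γ => (⟨X, hX.continuous⟩ : C(E, E)).comp γ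
  have hN : ContDiff ℂ 1 N := contDiff_postcomp hX
  let K : E →L[ℂ] C(Icc (0 : ℝ) 1, E) := ContinuousLinearMap.const ℂ _
  let G : (ℂ × E) × C(Icc (0 : ℝ) 1, E) → C(Icc (0 : ℝ) 1, E) :=
    fun x => x.2 - (K x.1.2 + x.1.1 • pathPrimitive E (N x.2))
  have hG : ContDiff ℂ 1 G := by fun_prop
  let u : (ℂ × E) × C(Icc (0 : ℝ) 1, E) := ((0, q), K q)
  have cdf : ContDiffAt ℂ 1 G u := hG.contDiffAt
  have hu : G u = 0 := by simp [G, u]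
  have hinr : fderiv ℂ G u ∘L .inr ℂ (ℂ × E) C(Icc (0 : ℝ) 1, E) = .id ℂ _ := by
    have h1 : HasFDerivAt (fun γ => G ((0, q), γ))
        (fderiv ℂ G u ∘L .inr ℂ (ℂ × E) C(Icc (0 : ℝ) 1, E)) (K q) :=
      ((hG.differentiable one_ne_zero) u).hasFDerivAt.comp (K q)
        (hasFDerivAt_prodMk_right ((0 : ℂ), q) (K q))
    have h2 : HasFDerivAt (fun γ => G ((0, q), γ)) (.id ℂ _) (K q) := by
      have : (fun γ => G ((0, q), γ)) = fun γ => γ - K q := by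
        ext γ; simp [G]
      rw [this]
      exact (hasFDerivAt_id _).sub_const _
    exact h1.unique h2
  have hinv : (fderiv ℂ G u ∘L .inr ℂ (ℂ × E) C(Icc (0 : ℝ) 1, E)).IsInvertible := by
    rw [hinr]; exact ⟨.refl ℂ _, rfl⟩
  let ψ := cdf.implicitFunction one_ne_zero hinv
  have hψ : ContDiffAt ℂ 1 ψ (0, q) := cdf.contDiffAt_implicitFunction one_ne_zero hinv
  have e1 : ∀ᶠ x in 𝓝 ((0 : ℂ), q), G (x, ψ x) = G u :=
    cdf.eventually_apply_implicitFunction one_ne_zero hinv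
  have e2 : ∀ᶠ x in 𝓝 ((0 : ℂ), q), DifferentiableAt ℂ ψ x :=
    (hψ.eventually (by simp)).mono fun x hx => hx.differentiableAt one_ne_zero
  have key : ∀ x, G (x, ψ x) = G u →
      x ∈ flowDomain X ∧ flow X x = ψ x ⟨1, zero_le_one, le_rfl⟩ := by
    rintro ⟨c, p⟩ hx
    have := isRay_of_integral_eq hX (p := p) (c := c) (γ := ψ (c, p))
      (sub_eq_zero.1 (hx.trans hu))
    exact ⟨this.mem, by rw [this.flow_eq hX, projIcc_right]⟩
  filter_upwards [e1.eventually_nhds, e2] with x hx hx2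
  refine ⟨(key x hx.self_of_nhds).1, ?_⟩
  have hd : DifferentiableAt ℂ (fun y => ψ y ⟨1, zero_le_one, le_rfl⟩) x :=
    (ContinuousMap.evalCLM ℂ (⟨1, zero_le_one, le_rfl⟩ : Icc (0 : ℝ) 1) :
      C(Icc (0 : ℝ) 1, E) →L[ℂ] E).differentiableAt.comp x hx2
  exact hd.congr_of_eventuallyEq (hx.mono fun y hy => (key y hy).2)

theorem mem_regularSet_trans (hX : ContDiff ℂ 1 X) {l : ℝ} (hl : l ∈ Ioo (0 : ℝ) 1)
    (h₁ : ((l : ℂ) * c, p) ∈ regularSet X)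
    (h₂ : (((1 - l : ℝ) : ℂ) * c, flow X (l * c, p)) ∈ regularSet X) :
    (c, p) ∈ regularSet X := by
  let f : ℂ × E → ℂ × E := fun y => ((l : ℂ) * y.1, y.2)
  let g : ℂ × E → ℂ × E := fun y => (((1 - l : ℝ) : ℂ) * y.1, flow X (f y))
  have hf : Continuous f := by fun_prop
  have hgd : ∀ y, DifferentiableAt ℂ (flow X) (f y) → DifferentiableAt ℂ g y := by
    intro y hy
    have h1 : DifferentiableAt ℂ f y := by fun_prop
    have h2 : DifferentiableAt ℂ (fun y => flow X (f y)) y := hy.comp y h1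
    fun_prop
  have hg : Filter.Tendsto g (𝓝 (c, p)) (𝓝 (g (c, p))) :=
    (hgd (c, p) h₁.self_of_nhds.2).continuousAt
  have ev : ∀ᶠ y in 𝓝 (c, p), (f y ∈ flowDomain X ∧ DifferentiableAt ℂ (flow X) (f y)) ∧
      (g y ∈ flowDomain X ∧ DifferentiableAt ℂ (flow X) (g y)) :=
    ((hf.continuousAt (x := (c, p))).eventually
      (p := fun y => y ∈ flowDomain X ∧ DifferentiableAt ℂ (flow X) y) h₁).and (hg.eventually h₂)
  filter_upwards [ev.eventually_nhds] with y hy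
  have hy0 := hy.self_of_nhds
  refine ⟨(flow_trans hX hl hy0.1.1 hy0.2.1).1, ?_⟩
  have : DifferentiableAt ℂ (fun y => flow X (g y)) y := hy0.2.2.comp y (hgd y hy0.1.2)
  exact this.congr_of_eventuallyEq (hy.mono fun z hz => (flow_trans hX hl hz.1.1 hz.2.1).2)

/-- The regular set contains a uniform time neighbourhood of any compact set of initial data. -/
theorem exists_ball_prod_subset_regularSet [CompleteSpace E] (hX : ContDiff ℂ 1 X) {K : Set E}
    (hK : IsCompact K) :
    ∃ τ > 0, ∀ c : ℂ, ‖c‖ < τ → ∀ p ∈ K, (c, p) ∈ regularSet X := by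
  have hsub : ({0} : Set ℂ) ×ˢ K ⊆ regularSet X := by
    rintro ⟨c, p⟩ ⟨hc, hp⟩
    obtain rfl : c = 0 := hc
    exact zero_mem_regularSet hX p
  obtain ⟨u, v, hu, hv, h0, hKv, huv⟩ :=
    generalized_tube_lemma isCompact_singleton hK isOpen_regularSet hsub
  obtain ⟨τ, hτ, hball⟩ := Metric.isOpen_iff.1 hu 0 (h0 rfl)
  exact ⟨τ, hτ, fun c hc p hp => huv ⟨hball (by simpa using hc), hKv hp⟩⟩

theorem flowDomain_subset_regularSet [CompleteSpace E] (hX : ContDiff ℂ 1 X) :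
    flowDomain X ⊆ regularSet X := by
  rintro ⟨c, p⟩ ⟨γ, hγ⟩
  simp only at hγ
  obtain ⟨τ, hτ, h⟩ := exists_ball_prod_subset_regularSet hX
    (isCompact_Icc.image_of_continuousOn hγ.continuousOn)
  obtain ⟨N, hN⟩ := exists_nat_gt (‖c‖ / τ)
  have hN0 : 0 < (N : ℝ) := (div_nonneg (norm_nonneg c) hτ.le).trans_lt hN
  have hsmall : ‖((1 / N : ℝ) : ℂ) * c‖ < τ := by
    rw [norm_mul, Complex.norm_real, Real.norm_of_nonneg (by positivity), one_div,
      inv_mul_lt_iff₀ hN0]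
    exact (div_lt_iff₀ hτ).1 hN
  have key : ∀ k : ℕ, k ≤ N → (((k / N : ℝ) : ℂ) * c, p) ∈ regularSet X := by
    intro k
    induction k with
    | zero => intro _; simpa using zero_mem_regularSet hX p
    | succ k ih =>
      intro hk
      have hkN : (k : ℝ) + 1 ≤ N := by exact_mod_cast hk
      have hmem : (k / N : ℝ) ∈ Icc (0 : ℝ) 1 :=
        ⟨by positivity, (div_le_one hN0).2 (by linarith)⟩
      rcases Nat.eq_zero_or_pos k with rfl | hk0
      · have := h _ hsmall p ⟨0, by simp, hγ.zero⟩
        simpa using this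
      · have hk0' : (0 : ℝ) < k := by exact_mod_cast hk0
        have h1 := ih (by omega)
        have hl : (k / (k + 1) : ℝ) ∈ Ioo (0 : ℝ) 1 :=
          ⟨by positivity, (div_lt_one (by positivity)).2 (by linarith)⟩
        have e1 : ((k / (k + 1) : ℝ) : ℂ) * ((((k + 1 : ℕ) / N : ℝ) : ℂ) * c) =
            ((k / N : ℝ) : ℂ) * c := by
          rw [← mul_assoc, ← Complex.ofReal_mul]; congr 2; push_cast; field_simp
        have e2 : ((1 - k / (k + 1) : ℝ) : ℂ) * ((((k + 1 : ℕ) / N : ℝ) : ℂ) * c) =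
            ((1 / N : ℝ) : ℂ) * c := by
          rw [← mul_assoc, ← Complex.ofReal_mul]; congr 2; push_cast; field_simp; ring
        refine mem_regularSet_trans hX hl (by rwa [e1]) ?_
        rw [e1, e2, hγ.flow_scale hX hmem]
        exact h _ hsmall _ ⟨_, hmem, rfl⟩
  simpa [div_self hN0.ne'] using key N le_rfl

theorem flowDomain_eq_regularSet [CompleteSpace E] (hX : ContDiff ℂ 1 X) :
    flowDomain X = regularSet X :=
  (flowDomain_subset_regularSet hX).antisymm fun _ hx => hx.self_of_nhds.1

theorem isOpen_flowDomain [CompleteSpace E] (hX : ContDiff ℂ 1 X) : IsOpen (flowDomain X) := by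
  rw [flowDomain_eq_regularSet hX]; exact isOpen_regularSet

theorem differentiableAt_flow [CompleteSpace E] (hX : ContDiff ℂ 1 X) {x : ℂ × E}
    (hx : x ∈ flowDomain X) : DifferentiableAt ℂ (flow X) x :=
  (flowDomain_subset_regularSet hX hx).self_of_nhds.2

theorem hasDerivAt_flow [CompleteSpace E] (hX : ContDiff ℂ 1 X) (h : (c, p) ∈ flowDomain X) :
    HasDerivAt (fun c => flow X (c, p)) (X (flow X (c, p))) c := by
  have key : ∀ c₁ : ℂ, c₁ ≠ 0 → (c₁, p) ∈ flowDomain X → ∀ l ∈ Icc (0 : ℝ) 1,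
      HasDerivAt (fun c => flow X (c, p)) (X (flow X ((l : ℂ) * c₁, p))) ((l : ℂ) * c₁) := by
    rintro c₁ hc₁ ⟨γ, hγ⟩ l hl
    simp only at hγ
    have hd : DifferentiableAt ℂ (fun c => flow X (c, p)) ((l : ℂ) * c₁) := by
      have h1 := differentiableAt_flow hX (hγ.scale hl).mem
      have h2 : DifferentiableAt ℂ (fun c : ℂ => (c, p)) ((l : ℂ) * c₁) := by fun_prop
      exact h1.comp ((l : ℂ) * c₁) h2
    have h1 : HasDerivWithinAt (fun l : ℝ => (l : ℂ) * c₁) c₁ (Icc 0 1) l := by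
      simpa using ((Complex.ofRealCLM.hasDerivAt (x := l)).mul_const c₁).hasDerivWithinAt
    have h2 := hd.hasDerivAt.scomp_hasDerivWithinAt l h1
    have h3 : HasDerivWithinAt ((fun c => flow X (c, p)) ∘ fun l : ℝ => (l : ℂ) * c₁)
        (c₁ • X (γ l)) (Icc 0 1) l :=
      (hγ.deriv l hl).congr (fun s hs => hγ.flow_scale hX hs) (hγ.flow_scale hX hl)
    have h4 := (uniqueDiffOn_Icc zero_lt_one l hl).eq_deriv _ h2 h3
    have h5 := smul_right_injective E hc₁ h4
    rw [hγ.flow_scale hX hl, ← h5]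
    exact hd.hasDerivAt
  by_cases hc : c = 0
  · subst hc
    obtain ⟨τ, hτ, hb⟩ := exists_ball_prod_subset_regularSet hX (isCompact_singleton (x := p))
    have h1 : (((τ / 2 : ℝ) : ℂ), p) ∈ flowDomain X := by
      rw [flowDomain_eq_regularSet hX]
      refine hb _ ?_ p rfl
      rw [Complex.norm_real, Real.norm_of_nonneg (by positivity)]
      linarith
    simpa using key _ (by simpa using hτ.ne') h1 0 (by simp)
  · simpa using key c hc h 1 (by simp)

theorem flowDomain_succ (hX : ContDiff ℂ 1 X) {N : ℕ} (hN : 0 < N) {k : ℕ} (hk : k < N)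
    (h₁ : (((k / N : ℝ) : ℂ) * c, p) ∈ flowDomain X)
    (h₂ : (((1 / N : ℝ) : ℂ) * c, flow X (((k / N : ℝ) : ℂ) * c, p)) ∈ flowDomain X) :
    ((((k + 1 : ℕ) / N : ℝ) : ℂ) * c, p) ∈ flowDomain X := by
  have hN0 : (0 : ℝ) < N := by exact_mod_cast hN
  rcases Nat.eq_zero_or_pos k with rfl | hk0
  · simpa [flow_zero hX] using h₂
  · have hk0' : (0 : ℝ) < k := by exact_mod_cast hk0
    have hl : (k / (k + 1) : ℝ) ∈ Ioo (0 : ℝ) 1 :=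
      ⟨by positivity, (div_lt_one (by positivity)).2 (by linarith)⟩
    have e1 : ((k / (k + 1) : ℝ) : ℂ) * ((((k + 1 : ℕ) / N : ℝ) : ℂ) * c) =
        ((k / N : ℝ) : ℂ) * c := by
      rw [← mul_assoc, ← Complex.ofReal_mul]; congr 2; push_cast; field_simp
    have e2 : ((1 - k / (k + 1) : ℝ) : ℂ) * ((((k + 1 : ℕ) / N : ℝ) : ℂ) * c) =
        ((1 / N : ℝ) : ℂ) * c := by
      rw [← mul_assoc, ← Complex.ofReal_mul]; congr 2; push_cast; field_simp; ring
    refine (flow_trans hX hl (by rwa [e1]) ?_).1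
    rwa [e1, e2]

theorem hasDerivAt_ofReal {Z : ℂ → E} {Z' : E} {s : ℝ} (h : HasDerivAt Z Z' (s : ℂ)) :
    HasDerivAt (fun s : ℝ => Z s) Z' s := by
  have := h.scomp s (Complex.ofRealCLM.hasDerivAt (x := s))
  simp only [Complex.ofRealCLM_apply, Complex.ofReal_one, one_smul] at this
  exact this

theorem flow_add_of_real [CompleteSpace E] (hX : ContDiff ℂ 1 X)
    (hreal : ∀ (a : ℝ) (p : E), ((a : ℂ), p) ∈ flowDomain X) (a b : ℝ) (p : E) :
    flow X (((b + a : ℝ) : ℂ), p) = flow X ((a : ℂ), flow X ((b : ℂ), p)) := by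
  have h : ∀ s : ℝ, HasDerivAt (fun s : ℝ => flow X ((s : ℂ), p)) (X (flow X ((s : ℂ), p))) s := by
    intro s
    exact hasDerivAt_ofReal (hasDerivAt_flow hX (hreal s p))
  have := (isRay_of_hasDerivAt_real (t := b) (a := a) h).flow_eq hX
  rw [this, one_mul]

theorem strip_subset_of_ball_subset [CompleteSpace E] (hX : ContDiff ℂ 1 X)
    (hreal : ∀ (a : ℝ) (p : E), ((a : ℂ), p) ∈ flowDomain X) {r : ℝ}
    (hr : ∀ c : ℂ, ‖c‖ < r → (c, p) ∈ flowDomain X) (hc : |c.im| < r) :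
    (c, p) ∈ flowDomain X := by
  let Z : ℂ → E := fun t => flow X ((t.re : ℂ), flow X ((t.im : ℂ) * Complex.I, p))
  have hg : ∀ w : ℂ, ‖w‖ < r →
      flow X ((w.re : ℂ), flow X ((w.im : ℂ) * Complex.I, p)) = flow X (w, p) := by
    intro w hw
    have := (isRay_of_hasDerivAt (X := X) (Z := fun c => flow X (c, p))
      (t := (w.im : ℂ) * Complex.I) (c := w.re) (fun l hl => hasDerivAt_flow hX (hr _ ?_))).flow_eq hX
    · rw [this]
      simp only [Complex.ofReal_one, one_mul]
      rw [add_comm, Complex.re_add_im]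
    · refine lt_of_le_of_lt ?_ hw
      rw [← sq_le_sq₀ (norm_nonneg _) (norm_nonneg _), Complex.sq_norm, Complex.sq_norm,
        Complex.normSq_apply, Complex.normSq_apply]
      simp
      have : l * w.re * (l * w.re) = l ^ 2 * (w.re * w.re) := by ring
      rw [this]
      exact mul_le_of_le_one_left (mul_self_nonneg _) (pow_le_one₀ hl.1 hl.2)
  have hZ : ∀ t : ℂ, |t.im| < r → HasDerivAt Z (X (Z t)) t := by
    intro t ht
    have ht' : ‖t - t.re‖ < r := by
      have : t - t.re = (t.im : ℂ) * Complex.I := by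
        linear_combination -(Complex.re_add_im t)
      rwa [this, norm_mul, Complex.norm_I, mul_one, Complex.norm_real]
    have hloc : ∀ᶠ w : ℂ in 𝓝 t, Z w = flow X ((t.re : ℂ), flow X (w - t.re, p)) := by
      have : ∀ᶠ w : ℂ in 𝓝 t, ‖w - t.re‖ < r :=
        (by fun_prop : ContinuousAt (fun w : ℂ => ‖w - t.re‖) t).eventually_lt
          continuousAt_const ht'
      filter_upwards [this] with w hw
      have h1 := hg _ hw
      have h2 := flow_add_of_real hX hreal t.re (w.re - t.re) (flow X ((w.im : ℂ) * Complex.I, p))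
      simp only [sub_add_cancel] at h2
      change flow X _ = _
      rw [h2, ← h1]
      simp
    have hdiff : DifferentiableAt ℂ Z t := by
      refine DifferentiableAt.congr_of_eventuallyEq ?_ hloc
      have h1 : DifferentiableAt ℂ (flow X) ((t.re : ℂ), flow X (t - t.re, p)) :=
        differentiableAt_flow hX (hreal _ _)
      have h2 : DifferentiableAt ℂ (flow X) (t - t.re, p) := differentiableAt_flow hX (hr _ ht')
      have h3 : DifferentiableAt ℂ (fun w : ℂ => (w - t.re, p)) t := by fun_prop
      have h4 : DifferentiableAt ℂ (fun w : ℂ => flow X (w - t.re, p)) t := DifferentiableAt.comp (g := flow X) t h2 h3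
      have h5 : DifferentiableAt ℂ (fun w : ℂ => ((t.re : ℂ), flow X (w - t.re, p))) t :=
        (differentiableAt_const _).prodMk h4
      exact h1.comp t h5
    have hA : HasDerivAt (fun s : ℝ => Z (t + s)) (deriv Z t) 0 := by
      have h1 : HasDerivAt Z (deriv Z t) (t + ((0 : ℝ) : ℂ)) := by simpa using hdiff.hasDerivAt
      exact hasDerivAt_ofReal (h1.comp_const_add t _)
    have hB : HasDerivAt (fun s : ℝ => Z (t + s)) (X (Z t)) 0 := by
      let q := flow X ((t.im : ℂ) * Complex.I, p)
      have h1 := (hasDerivAt_flow hX (hreal (t.re + (0 : ℝ)) q))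
      rw [Complex.ofReal_add] at h1
      have h2 := hasDerivAt_ofReal (h1.comp_const_add (t.re : ℂ) _)
      simpa [Z, q] using h2
    rw [← hA.unique hB]
    exact hdiff.hasDerivAt
  have hray := isRay_of_hasDerivAt (X := X) (Z := Z) (t := 0) (c := c) (fun l hl => hZ _ ?_)
  · have : Z 0 = p := by simp [Z, flow_zero hX]
    rw [this] at hray
    exact hray.mem
  · simp only [zero_add, Complex.mul_im, Complex.ofReal_re, Complex.ofReal_im, zero_mul, add_zero,
      abs_mul, abs_of_nonneg hl.1]
    exact (mul_le_of_le_one_left (abs_nonneg _) hl.2).trans_lt hc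

/-- Continuity principle: holomorphic discs of times whose boundary lies in the flow domain lie in
the flow domain. -/
theorem mem_flowDomain_of_sphere [ProperSpace E] [CompleteSpace E] (hX : ContDiff ℂ 1 X)
    {P : ℂ → E} {h : ℂ → ℂ} (hP : Differentiable ℂ P) (hh : Differentiable ℂ h) {r : ℝ}
    (hr : 0 < r)
    (hs : ∀ σ ∈ Metric.sphere (0 : ℂ) r, (h σ, P σ) ∈ flowDomain X) {σ : ℂ}
    (hσ : σ ∈ Metric.closedBall (0 : ℂ) r) : (h σ, P σ) ∈ flowDomain X := by
  have hc : ContinuousOn (fun x : ℝ × ℂ => flow X ((x.1 : ℂ) * h x.2, P x.2))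
      (Icc (0 : ℝ) 1 ×ˢ Metric.sphere (0 : ℂ) r) := by
    rintro ⟨l, σ⟩ ⟨hl, hσ⟩
    have h1 := (differentiableAt_flow hX (flowDomain_scale (hs σ hσ) hl)).continuousAt
    have hP' := hP.continuous
    have hh' := hh.continuous
    have h2 : Continuous (fun x : ℝ × ℂ => ((x.1 : ℂ) * h x.2, P x.2)) := by fun_prop
    exact (h1.comp (f := fun x : ℝ × ℂ => ((x.1 : ℂ) * h x.2, P x.2)) (x := (l, σ))
      h2.continuousAt).continuousWithinAt
  obtain ⟨C, hC⟩ := (isCompact_Icc.prod (isCompact_sphere (0 : ℂ) r)).exists_bound_of_continuousOn hc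
  obtain ⟨τ, hτ, hball⟩ := exists_ball_prod_subset_regularSet hX
    (isCompact_closedBall (0 : E) C)
  rw [← flowDomain_eq_regularSet hX] at hball
  obtain ⟨H, hH⟩ := (isCompact_closedBall (0 : ℂ) r).exists_bound_of_continuousOn
    hh.continuous.continuousOn
  obtain ⟨N, hN⟩ := exists_nat_gt (H / τ)
  have hH0 : 0 ≤ H := (norm_nonneg _).trans (hH σ hσ)
  have hN0 : 0 < (N : ℝ) := (div_nonneg hH0 hτ.le).trans_lt hN
  have key : ∀ k : ℕ, k ≤ N → ∀ σ ∈ Metric.closedBall (0 : ℂ) r,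
      (((k / N : ℝ) : ℂ) * h σ, P σ) ∈ flowDomain X := by
    intro k
    induction k with
    | zero => intro _ σ _; simpa using zero_mem_flowDomain
    | succ k ih =>
      intro hk σ hσ
      have ih' := ih (by omega)
      have hkN : (k : ℝ) + 1 ≤ N := by exact_mod_cast hk
      have hmem : (k / N : ℝ) ∈ Icc (0 : ℝ) 1 :=
        ⟨by positivity, (div_le_one hN0).2 (by linarith)⟩
      refine flowDomain_succ hX (by exact_mod_cast hN0) (by omega) (ih' σ hσ) (hball _ ?_ _ ?_)
      · rw [norm_mul, Complex.norm_real, Real.norm_of_nonneg (by positivity), one_div,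
          inv_mul_lt_iff₀ hN0]
        exact (hH σ hσ).trans_lt ((div_lt_iff₀ hτ).1 hN)
      · rw [mem_closedBall_zero_iff]
        have hd : ∀ σ ∈ Metric.closedBall (0 : ℂ) r,
            DifferentiableAt ℂ (fun σ => flow X (((k / N : ℝ) : ℂ) * h σ, P σ)) σ := by
          intro σ hσ
          have h1 := differentiableAt_flow hX (ih' σ hσ)
          have h2 : DifferentiableAt ℂ (fun σ => (((k / N : ℝ) : ℂ) * h σ, P σ)) σ := by
            have := hP σ
            have := hh σ
            fun_prop
          exact h1.comp σ h2
        have hcl : closure (Metric.ball (0 : ℂ) r) = Metric.closedBall 0 r :=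
          closure_ball 0 hr.ne'
        refine Complex.norm_le_of_forall_mem_frontier_norm_le (U := Metric.ball (0 : ℂ) r)
          (f := fun σ => flow X (((k / N : ℝ) : ℂ) * h σ, P σ)) Metric.isBounded_ball
          (DifferentiableOn.diffContOnCl fun σ hσ => (hd σ (hcl ▸ hσ)).differentiableWithinAt)
          (fun σ hσ => ?_) (hcl ▸ hσ)
        rw [frontier_ball 0 hr.ne'] at hσ
        exact hC (k / N, σ) ⟨hmem, hσ⟩
  simpa [div_self hN0.ne'] using key N le_rfl σ hσ

set_option maxHeartbeats 1000000 in
/-- If all initial data in the unit ball flow for times `‖c‖ < τ`, then so do all initial data. -/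
theorem mem_flowDomain_of_unit_ball [ProperSpace E] [CompleteSpace E] (hX : ContDiff ℂ 1 X)
    (hreal : ∀ (a : ℝ) (p : E), ((a : ℂ), p) ∈ flowDomain X) {τ : ℝ}
    (hτ : ∀ c : ℂ, ‖c‖ < τ → ∀ p : E, ‖p‖ ≤ 1 → (c, p) ∈ flowDomain X) {c₀ : ℂ}
    (hc₀ : ‖c₀‖ < τ) (p₀ : E) : (c₀, p₀) ∈ flowDomain X := by
  by_contra hcon
  have hp₀ : 1 < ‖p₀‖ := by
    by_contra! h
    exact hcon (hτ c₀ hc₀ p₀ h)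
  have hτ0 : 0 < τ := (norm_nonneg _).trans_lt hc₀
  set L₀ := Real.log ‖p₀‖ with hL₀
  have hL₀pos : 0 < L₀ := Real.log_pos hp₀
  obtain ⟨ε, hε, hεL⟩ : ∃ ε > 0, ‖c₀‖ + ε * L₀ < τ := by
    refine ⟨(τ - ‖c₀‖) / (2 * L₀), div_pos (by linarith) (by positivity), ?_⟩
    have : (τ - ‖c₀‖) / (2 * L₀) * L₀ = (τ - ‖c₀‖) / 2 := by field_simp
    rw [this]; linarith
  set M := 2 * τ / ε with hM
  have hεM : ε * M = 2 * τ := by rw [hM]; field_simp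
  have hMpos : 0 < M := by positivity
  set η := τ / M ^ 2 with hη
  have hηpos : 0 < η := by positivity
  have hηM : η * M ^ 2 = τ := by rw [hη]; field_simp
  have hηM' : 2 * (η * M) = ε := by
    have : (2 * (η * M) - ε) * M = 0 := by nlinarith
    rcases mul_eq_zero.1 this with h | h
    · linarith
    · exact absurd h hMpos.ne'
  have hL₀M : L₀ < M := by
    by_contra! h
    nlinarith [norm_nonneg c₀]
  let J : ℂ × E → ℝ := fun x => ‖x.1‖ + ε * Real.log ‖x.2‖ - η * Real.log ‖x.2‖ ^ 2
  let S : Set (ℂ × E) := ((flowDomain X)ᶜ ∩ (Metric.closedBall 0 τ ×ˢ Metric.closedBall 0 (Real.exp M)))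
    ∩ {x | 1 ≤ ‖x.2‖}
  have hS : IsCompact S :=
    (((isCompact_closedBall _ _).prod (isCompact_closedBall _ _)).inter_left
      (isOpen_flowDomain hX).isClosed_compl).inter_right (isClosed_le continuous_const (by fun_prop))
  have hlogle : ∀ p : E, 1 ≤ ‖p‖ → (‖p‖ ≤ Real.exp M ↔ Real.log ‖p‖ ≤ M) := fun p hp =>
    (Real.log_le_iff_le_exp (by linarith)).symm
  have memS : ∀ c p, (c, p) ∈ S ↔
      (c, p) ∉ flowDomain X ∧ ‖c‖ ≤ τ ∧ 1 ≤ ‖p‖ ∧ Real.log ‖p‖ ≤ M := by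
    intro c p
    constructor
    · rintro ⟨⟨h1, h2, h3⟩, h4⟩
      exact ⟨h1, by simpa using h2, h4, (hlogle p h4).1 (by simpa using h3)⟩
    · rintro ⟨h1, h2, h3, h4⟩
      exact ⟨⟨h1, by simpa using h2, by simpa using (hlogle p h3).2 h4⟩, h3⟩
  have h₀S : (c₀, p₀) ∈ S := (memS _ _).2 ⟨hcon, hc₀.le, hp₀.le, hL₀M.le⟩
  have hJc : ContinuousOn J S := by
    have : ∀ x ∈ S, ‖x.2‖ ≠ 0 := fun x hx => by
      have : 1 ≤ ‖x.2‖ := hx.2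
      linarith
    have hl : ContinuousOn (fun x : ℂ × E => Real.log ‖x.2‖) S :=
      ContinuousOn.log (by fun_prop) this
    fun_prop
  obtain ⟨⟨c₁, p₁⟩, h₁S, hmin⟩ := hS.exists_isMinOn ⟨_, h₀S⟩ hJc
  obtain ⟨h₁, hc₁τ, hp₁, hL₁M⟩ := (memS _ _).1 h₁S
  have hmin' : ∀ c p, (c, p) ∉ flowDomain X → ‖c‖ ≤ τ → 1 ≤ ‖p‖ → Real.log ‖p‖ ≤ M →
      J (c₁, p₁) ≤ J (c, p) := fun c p h1 h2 h3 h4 => hmin ((memS c p).2 ⟨h1, h2, h3, h4⟩)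
  have hJ₁ : J (c₁, p₁) < τ := by
    have := hmin' _ _ hcon hc₀.le hp₀.le hL₀M.le
    refine this.trans_lt ?_
    simp only [J]
    nlinarith [sq_nonneg L₀]
  set L₁ := Real.log ‖p₁‖ with hL₁
  have hJ₁' : ‖c₁‖ + ε * L₁ - η * L₁ ^ 2 < τ := hJ₁
  have hL₁pos : 0 < L₁ := by
    refine (Real.log_nonneg hp₁).lt_of_ne fun h => ?_
    have hp1 : ‖p₁‖ ≤ 1 := by
      by_contra! h'
      exact (Real.log_pos h').ne h
    rw [← hL₁] at h
    rw [← h] at hJ₁'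
    exact h₁ (hτ c₁ (by linarith) p₁ hp1)
  have hL₁M' : L₁ < M := by
    refine hL₁M.lt_of_ne fun h => ?_
    rw [h] at hJ₁'
    linarith [norm_nonneg c₁]
  have hc₁lt : ‖c₁‖ < τ := by
    have := mul_pos (mul_pos hηpos hL₁pos) (show 0 < 2 * M - L₁ by linarith)
    rw [← hηM'] at hJ₁'
    linarith
  have hc₁pos : 0 < ‖c₁‖ := by
    refine norm_pos_iff.2 ?_
    rintro rfl
    exact h₁ zero_mem_flowDomain
  have hball : ∀ c : ℂ, ‖c‖ < ‖c₁‖ → (c, p₁) ∈ flowDomain X := by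
    intro c hc
    by_contra hn
    have := hmin' c p₁ hn (hc.le.trans hc₁τ) hp₁ hL₁M
    simp only [J] at this
    linarith
  have him : ‖c₁‖ ≤ |c₁.im| := by
    by_contra! h
    exact h₁ (strip_subset_of_ball_subset hX hreal hball h)
  have hre : c₁.re = 0 := by
    have h1 := Complex.sq_norm c₁
    rw [Complex.normSq_apply] at h1
    have h2 : ‖c₁‖ ^ 2 ≤ c₁.im ^ 2 := by
      rw [← sq_abs c₁.im]; gcongr
    nlinarith [mul_self_nonneg c₁.re]
  let H : ℂ → ℂ := fun σ => -ε * σ + η * (2 * L₁ * σ + σ ^ 2 / 2)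
  have hHd : Differentiable ℂ H := by fun_prop
  have hH0 : H 0 = 0 := by simp [H]
  obtain ⟨r₀, hr₀, hHr⟩ := Metric.continuousAt_iff.1 (hHd.continuous.continuousAt (x := 0))
    (min ‖c₁‖ (τ - ‖c₁‖)) (lt_min hc₁pos (by linarith))
  obtain ⟨r, hr, hrr₀, hrL, hrM⟩ : ∃ r > 0, r < r₀ ∧ r ≤ L₁ ∧ r ≤ M - L₁ := by
    refine ⟨min (r₀ / 2) (min L₁ (M - L₁)), lt_min (by linarith) (lt_min hL₁pos (by linarith)),
      (min_le_left _ _).trans_lt (by linarith), (min_le_right _ _).trans (min_le_left _ _),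
      (min_le_right _ _).trans (min_le_right _ _)⟩
  let P : ℂ → E := fun σ => Complex.exp σ • p₁
  let h : ℂ → ℂ := fun σ => c₁ * (1 + H σ / ‖c₁‖)
  have hfin : (h 0, P 0) ∈ flowDomain X := by
    refine mem_flowDomain_of_sphere hX (P := P) (h := h) (by fun_prop) (by fun_prop) hr
      (fun σ hσ => ?_) (Metric.mem_closedBall_self hr.le)
    have hσr : ‖σ‖ = r := by simpa using hσ
    have hσre : |σ.re| ≤ r := hσr ▸ Complex.abs_re_le_norm σ
    obtain ⟨hσ1, hσ2⟩ := abs_le.1 hσre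
    have hHσ : ‖H σ‖ < min ‖c₁‖ (τ - ‖c₁‖) := by
      have := hHr (x := σ) (by simpa [hσr] using hrr₀)
      rwa [hH0, dist_zero_right] at this
    have hHre : |(H σ).re| < min ‖c₁‖ (τ - ‖c₁‖) := (Complex.abs_re_le_norm _).trans_lt hHσ
    obtain ⟨hH1, hH2⟩ := abs_lt.1 hHre
    have hH3 := min_le_left ‖c₁‖ (τ - ‖c₁‖)
    have hH4 := min_le_right ‖c₁‖ (τ - ‖c₁‖)
    have hReH : (H σ).re = -ε * σ.re + η * (2 * L₁ * σ.re + (σ.re ^ 2 - σ.im ^ 2) / 2) := by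
      simp [H, pow_two]
    have hsq : σ.re ^ 2 + σ.im ^ 2 = r ^ 2 := by
      rw [← hσr, Complex.sq_norm, Complex.normSq_apply]; ring
    have hPn : ‖P σ‖ = Real.exp σ.re * ‖p₁‖ := by
      simp [P, norm_smul, Complex.norm_exp]
    have hPlog : Real.log ‖P σ‖ = σ.re + L₁ := by
      rw [hPn, Real.log_mul (Real.exp_pos _).ne' (by linarith), Real.log_exp]
    have hP1 : 1 ≤ ‖P σ‖ := by
      have h1 : 0 < ‖P σ‖ := by rw [hPn]; have := Real.exp_pos σ.re; positivity
      rw [← Real.log_nonneg_iff h1, hPlog]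
      linarith
    refine strip_subset_of_ball_subset hX hreal
      (r := min τ (‖c₁‖ + (H σ).re + η * r ^ 2 / 2)) (fun c hc => ?_) ?_
    · by_contra hn
      have h1 := hmin' c (P σ) hn (hc.le.trans (min_le_left _ _)) hP1 (by rw [hPlog]; linarith)
      have h2 := hc.trans_le (min_le_right _ _)
      simp only [J, hPlog, ← hL₁, hReH] at h1 h2
      have h3 : η * r ^ 2 = η * σ.re ^ 2 + η * σ.im ^ 2 := by rw [← hsq]; ring
      linarith
    · have e : (h σ).im = c₁.im * (1 + (H σ).re / ‖c₁‖) := by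
        simp [h, Complex.mul_im, hre, Complex.div_ofReal_re]
      have e2 : |(h σ).im| ≤ ‖c₁‖ + (H σ).re := by
        have h3 : 1 + (H σ).re / ‖c₁‖ = (‖c₁‖ + (H σ).re) / ‖c₁‖ := by field_simp
        rw [e, abs_mul, h3, abs_div, abs_of_pos (a := ‖c₁‖ + (H σ).re) (by linarith),
          abs_of_pos hc₁pos]
        calc |c₁.im| * ((‖c₁‖ + (H σ).re) / ‖c₁‖)
            ≤ ‖c₁‖ * ((‖c₁‖ + (H σ).re) / ‖c₁‖) := by
              gcongr
              · exact div_nonneg (by linarith) hc₁pos.le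
              · exact Complex.abs_im_le_norm c₁
          _ = _ := by field_simp
      refine e2.trans_lt (lt_min (by linarith) ?_)
      have : 0 < η * r ^ 2 / 2 := by positivity
      linarith
  have e1 : h 0 = c₁ := by simp [h, hH0]
  have e2 : P 0 = p₁ := by simp [P]
  rw [e1, e2] at hfin
  exact h₁ hfin

/-- A holomorphic vector field on a finite-dimensional space which is complete in real time is
complete in complex time. -/
theorem flowDomain_eq_univ [ProperSpace E] [CompleteSpace E] (hX : ContDiff ℂ 1 X)
    (hreal : ∀ (a : ℝ) (p : E), ((a : ℂ), p) ∈ flowDomain X) : flowDomain X = univ := by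
  obtain ⟨τ, hτ, hb⟩ := exists_ball_prod_subset_regularSet hX (isCompact_closedBall (0 : E) 1)
  rw [← flowDomain_eq_regularSet hX] at hb
  have hb' : ∀ c : ℂ, ‖c‖ < τ → ∀ p, (c, p) ∈ flowDomain X := fun c hc p =>
    mem_flowDomain_of_unit_ball hX hreal (fun c hc p hp => hb c hc p (by simpa using hp)) hc p
  refine eq_univ_of_forall fun ⟨c, p⟩ => ?_
  obtain ⟨N, hN⟩ := exists_nat_gt (‖c‖ / τ)
  have hN0 : 0 < (N : ℝ) := (div_nonneg (norm_nonneg _) hτ.le).trans_lt hN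
  have key : ∀ k : ℕ, k ≤ N → (((k / N : ℝ) : ℂ) * c, p) ∈ flowDomain X := by
    intro k
    induction k with
    | zero => intro _; simpa using zero_mem_flowDomain
    | succ k ih =>
      intro hk
      refine flowDomain_succ hX (by exact_mod_cast hN0) (by omega) (ih (by omega)) (hb' _ ?_ _)
      rw [norm_mul, Complex.norm_real, Real.norm_of_nonneg (by positivity), one_div,
        inv_mul_lt_iff₀ hN0]
      exact (div_lt_iff₀ hτ).1 hN
  simpa [div_self hN0.ne'] using key N le_rfl

end Flow

section SecondOrder

/-- `z` is an entire solution of `z'' = f z`, with velocity `v`. -/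
structure IsSol (f z v : ℂ → ℂ) : Prop where
  pos : ∀ t, HasDerivAt z (v t) t
  vel : ∀ t, HasDerivAt v (f (z t)) t

variable {f F z v z₁ v₁ z₂ v₂ : ℂ → ℂ} {a : ℂ}

theorem IsSol.translate (h : IsSol f z v) (a : ℂ) :
    IsSol f (fun t => z (a + t)) (fun t => v (a + t)) :=
  ⟨fun t => (h.pos (a + t)).comp_const_add a t, fun t => (h.vel (a + t)).comp_const_add a t⟩

theorem IsSol.reverse (h : IsSol f z v) (a : ℂ) :
    IsSol f (fun t => z (a - t)) (fun t => -v (a - t)) :=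
  ⟨fun t => (h.pos (a - t)).comp_const_sub a t,
    fun t => by
      have := ((h.vel (a - t)).comp_const_sub a t).neg
      rw [neg_neg] at this
      exact this⟩

/-- The first-order vector field of `z'' = f z`. -/
def phaseField (f : ℂ → ℂ) (x : ℂ × ℂ) : ℂ × ℂ := (x.2, f x.1)

theorem contDiff_phaseField (hf : Differentiable ℂ f) : ContDiff ℂ 1 (phaseField f) := by
  have := hf.contDiff (n := 1)
  unfold phaseField
  fun_prop

theorem IsSol.hasDerivAt (h : IsSol f z v) (t : ℂ) :
    HasDerivAt (fun t => (z t, v t)) (phaseField f (z t, v t)) t :=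
  (h.pos t).prodMk (h.vel t)

theorem IsSol.eq (hf : Differentiable ℂ f) (h₁ : IsSol f z₁ v₁) (h₂ : IsSol f z₂ v₂)
    (hz : z₁ 0 = z₂ 0) (hv : v₁ 0 = v₂ 0) (t : ℂ) : z₁ t = z₂ t := by
  have r₁ := isRay_of_hasDerivAt (t := 0) (c := t) fun l _ => h₁.hasDerivAt (0 + l * t)
  have r₂ := isRay_of_hasDerivAt (t := 0) (c := t) fun l _ => h₂.hasDerivAt (0 + l * t)
  rw [hz, hv] at r₁
  have := r₁.eqOn (contDiff_phaseField hf) r₂ (right_mem_Icc.2 zero_le_one)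
  simpa using congrArg Prod.fst this

theorem IsSol.differentiable (h : IsSol f z v) : Differentiable ℂ z :=
  fun t => (h.pos t).differentiableAt

theorem IsSol.energy (hF : ∀ w, HasDerivAt F (f w) w) (h : IsSol f z v) (t : ℂ) :
    v t ^ 2 - 2 * F (z t) = v 0 ^ 2 - 2 * F (z 0) := by
  have hd : ∀ t, HasDerivAt (fun t => v t ^ 2 - 2 * F (z t)) 0 t := by
    intro t
    have h1 := ((h.vel t).pow 2).sub (((hF (z t)).comp t (h.pos t)).const_mul 2)
    convert! h1 using 1
    simp; ring
  exact is_const_of_deriv_eq_zero (fun t => (hd t).differentiableAt) (fun t => (hd t).deriv) t 0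

theorem IsSol.isOpenMap (h : IsSol f z v) (h0 : v 0 ≠ 0 ∨ f (z 0) ≠ 0) : IsOpenMap z := by
  refine (AnalyticOnNhd.is_constant_or_isOpenMap
    (fun t _ => h.differentiable.analyticAt t)).resolve_left ?_
  rintro ⟨w, hw⟩
  have hv : ∀ t, v t = 0 := by
    intro t
    have : HasDerivAt z 0 t := by
      rw [show z = fun _ => w from funext hw]; exact hasDerivAt_const t w
    exact (h.pos t).unique this
  have hf0 : f (z 0) = 0 := by
    have : HasDerivAt v 0 0 := by
      rw [show v = fun _ => 0 from funext hv]; exact hasDerivAt_const 0 0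
    exact (h.vel 0).unique this
  rcases h0 with h0 | h0
  · exact h0 (hv 0)
  · exact h0 hf0

theorem countable_zeros (hf : Differentiable ℂ f) (h0 : f a ≠ 0) : {w | f w = 0}.Countable := by
  have h := AnalyticOnNhd.eqOn_zero_or_eventually_ne_zero_of_preconnected (U := univ)
    (fun w _ => hf.analyticAt w) isPreconnected_univ
  have h := h.resolve_left fun h => h0 (h (mem_univ a))
  refine (HereditarilyLindelofSpace.isLindelof _).countable_of_isDiscrete
    ((isDiscrete_of_codiscreteWithin (U := univ) ?_).mono fun _ hx => ⟨hx, mem_univ _⟩)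
  simpa using! h

/-- A solution starting at rest visits every noncritical point of its energy level. -/
theorem IsSol.exists_eq (hf : Differentiable ℂ f) (hF : ∀ w, HasDerivAt F (f w) w)
    (hcomp : ∀ z₀ v₀, ∃ z v, IsSol f z v ∧ z 0 = z₀ ∧ v 0 = v₀) (h : IsSol f z v)
    (hv0 : v 0 = 0) (hf0 : f (z 0) ≠ 0) (hFa : F a = F (z 0)) (hfa : f a ≠ 0) :
    ∃ t, z t = a ∧ v t = 0 := by
  have en : ∀ t, v t ^ 2 = 2 * (F (z t) - F (z 0)) := by
    intro t
    have := h.energy hF t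
    rw [hv0] at this
    linear_combination this
  let D : Set ℂ := {w | F w = F (z 0) ∧ f w = 0}
  have hD : D.Countable := (countable_zeros hf hf0).mono fun w hw => hw.2
  have hpre : IsPreconnected Dᶜ :=
    (hD.isConnected_compl_of_one_lt_rank (by rw [Complex.rank_real_complex]; norm_num)).isPreconnected
  have hopen : IsOpen (range z) := (h.isOpenMap (Or.inr hf0)).isOpen_range
  have hsub : Dᶜ ⊆ range z := by
    refine hpre.subset_of_closure_inter_subset hopen ⟨z 0, fun h => hf0 h.2, mem_range_self 0⟩ ?_
    rintro w ⟨hw, hwD⟩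
    obtain ⟨u, hu⟩ := IsAlgClosed.exists_pow_nat_eq (2 * (F w - F (z 0))) (n := 2) (by norm_num)
    obtain ⟨y, y', hy, hy0, hy'0⟩ := hcomp w u
    have hy_open : IsOpenMap y := by
      refine hy.isOpenMap ?_
      by_contra! hc
      rw [hy'0, hy0] at hc
      refine hwD ⟨?_, hc.2⟩
      rw [hc.1] at hu
      linear_combination -hu / 2
    obtain ⟨_, ⟨t', rfl⟩, ⟨t'', ht⟩⟩ := mem_closure_iff.1 hw _ hy_open.isOpen_range ⟨0, hy0⟩
    have e : (y' t' - v t'') * (y' t' + v t'') = 0 := by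
      have h1 := hy.energy hF t'
      have h2 := en t''
      rw [hy0, hy'0] at h1
      rw [ht] at h2
      linear_combination h1 - h2 + hu
    rcases mul_eq_zero.1 e with e | e
    · have := (hy.translate t').eq hf (h.translate t'') (by simpa using ht.symm)
        (by simpa using sub_eq_zero.1 e) (-t')
      exact ⟨t'' + -t', by rw [← this]; simp [hy0]⟩
    · have := (hy.translate t').eq hf (h.reverse t'') (by simpa using ht.symm)
        (by simpa using eq_neg_of_add_eq_zero_left e) (-t')
      exact ⟨t'' - -t', by rw [← this]; simp [hy0]⟩
  obtain ⟨t, ht⟩ := hsub (show a ∈ Dᶜ from fun h => hfa h.2)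
  refine ⟨t, ht, ?_⟩
  have := en t
  rw [ht, hFa, sub_self, mul_zero] at this
  exact pow_eq_zero_iff two_ne_zero |>.1 this

theorem IsSol.symm (hf : Differentiable ℂ f) (h : IsSol f z v) (ha : v a = 0) (s : ℂ) :
    z (a + s) = z (a - s) :=
  (h.translate a).eq hf (h.reverse a) (by simp) (by simp [ha]) s

/-- The group of periods of a function. -/
def periods (z : ℂ → ℂ) : AddSubgroup ℂ where
  carrier := {p | ∀ s, z (s + p) = z s}
  zero_mem' := by simp
  add_mem' := fun {p q} hp hq s => by rw [← add_assoc, hq, hp]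
  neg_mem' := fun {p} hp s => by simpa using (hp (s + -p)).symm

theorem IsSol.two_mul_mem_periods (hf : Differentiable ℂ f) (h : IsSol f z v) (h0 : v 0 = 0)
    (ha : v a = 0) : 2 * a ∈ periods z := fun s => by
  have h1 := h.symm hf ha (a + s)
  have h2 := h.symm hf h0 s
  simp only [zero_add, zero_sub, sub_add_cancel_left] at h1 h2
  rw [h2, ← h1]
  congr 1; ring

/-- An entire function with two real-independent periods is constant. -/
theorem apply_eq_apply_of_periods (hz : Differentiable ℂ z) {p q : ℂ} (hp : p ∈ periods z)
    (hq : q ∈ periods z) (hp0 : p ≠ 0) (him : (q / p).im ≠ 0) (s t : ℂ) : z s = z t := by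
  refine hz.apply_eq_apply_of_bounded ?_ s t
  have hc : Continuous fun x : ℝ × ℝ => z (x.1 * p + x.2 * q) := by
    have := hz.continuous
    fun_prop
  obtain ⟨C, hC⟩ := (isCompact_Icc.prod isCompact_Icc :
    IsCompact (Icc (0 : ℝ) 1 ×ˢ Icc (0 : ℝ) 1)).exists_bound_of_continuousOn hc.continuousOn
  refine isBounded_iff_forall_norm_le.2 ⟨C, ?_⟩
  rintro _ ⟨s, rfl⟩
  set w := q / p with hw
  set β : ℝ := (s / p).im / w.im
  set α : ℝ := (s / p).re - β * w.re
  have hs : s / p = α + β * w := by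
    apply Complex.ext <;> simp [α, β]
    field_simp
  have hs' : s = α * p + β * q := by
    rw [div_eq_iff hp0] at hs
    rw [hs, hw]; field_simp
  have hper : (⌊α⌋ • p + ⌊β⌋ • q) ∈ periods z :=
    add_mem (zsmul_mem hp _) (zsmul_mem hq _)
  have := hC (Int.fract α, Int.fract β)
    ⟨⟨Int.fract_nonneg _, (Int.fract_lt_one _).le⟩, ⟨Int.fract_nonneg _, (Int.fract_lt_one _).le⟩⟩
  simp only at this
  rw [← hper] at this
  convert! this using 3
  rw [hs']
  simp only [Int.fract, zsmul_eq_mul]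
  push_cast
  ring

theorem no_three_on_level (hf : Differentiable ℂ f) (hF : ∀ w, HasDerivAt F (f w) w)
    (hcomp : ∀ z₀ v₀, ∃ z v, IsSol f z v ∧ z 0 = z₀ ∧ v 0 = v₀) {a₁ a₂ a₃ : ℂ}
    (h₁ : f a₁ ≠ 0) (h₂ : f a₂ ≠ 0) (h₃ : f a₃ ≠ 0) (h₁₂ : a₁ ≠ a₂) (h₁₃ : a₁ ≠ a₃)
    (h₂₃ : a₂ ≠ a₃) (hF₂ : F a₂ = F a₁) (hF₃ : F a₃ = F a₁) : False := by
  obtain ⟨z, v, h, rfl, hv0⟩ := hcomp a₁ 0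
  obtain ⟨t₂, rfl, hv₂⟩ := h.exists_eq hf hF hcomp hv0 h₁ hF₂ h₂
  obtain ⟨t₃, rfl, hv₃⟩ := h.exists_eq hf hF hcomp hv0 h₁ hF₃ h₃
  have p₂ := h.two_mul_mem_periods hf hv0 hv₂
  have p₃ := h.two_mul_mem_periods hf hv0 hv₃
  have ht₂ : t₂ ≠ 0 := fun h => h₁₂ (by rw [h])
  by_cases him : (2 * t₃ / (2 * t₂)).im = 0
  swap
  · exact h₁₂ (apply_eq_apply_of_periods h.differentiable p₂ p₃ (by simpa) him _ _)
  obtain ⟨x, hx⟩ : ∃ x : ℝ, t₃ = x * t₂ := by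
    refine ⟨(2 * t₃ / (2 * t₂)).re, ?_⟩
    have : ((2 * t₃ / (2 * t₂)).re : ℂ) = 2 * t₃ / (2 * t₂) :=
      Complex.ext (by simp) (by simpa using him.symm)
    rw [this]; field_simp
  let A : AddSubgroup ℝ :=
    (periods z).comap ((AddMonoidHom.mulRight t₂).comp Complex.ofRealHom.toAddMonoidHom)
  have memA : ∀ y : ℝ, y ∈ A ↔ ∀ s, z (s + y * t₂) = z s := fun y => Iff.rfl
  have hAc : IsClosed (A : Set ℝ) := by
    have : (A : Set ℝ) = ⋂ s, {y : ℝ | z (s + y * t₂) = z s} := by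
      ext y; simp [memA]
    rw [this]
    refine isClosed_iInter fun s => isClosed_eq ?_ continuous_const
    have := h.differentiable.continuous
    fun_prop
  have hone : (1 : ℝ) ∉ A := fun h1 => h₁₂ (by simpa using ((memA 1).1 h1 0).symm)
  have hxA : x ∉ A := fun h1 => h₁₃ (by
    have := ((memA x).1 h1 0).symm
    rwa [zero_add, ← hx] at this)
  have h1x : 1 - x ∉ A := fun h1 => h₂₃ (by
    have := (memA _).1 h1 t₃
    rw [← this, hx]
    congr 1; push_cast; ring)
  have h2A : (2 : ℝ) ∈ A := by
    rw [memA]; intro s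
    simpa using p₂ s
  have h2xA : 2 * x ∈ A := by
    rw [memA]; intro s
    have := p₃ s
    rw [hx] at this
    rw [← this]; congr 1; push_cast; ring
  rcases A.dense_or_cyclic with hd | ⟨ω, hω⟩
  · have := hd.closure_eq
    rw [hAc.closure_eq] at this
    exact hone (this.symm.subset (mem_univ (1 : ℝ)))
  · have hωA : ω ∈ A := by rw [hω]; exact AddSubgroup.mem_closure_singleton_self ω
    have hmul : ∀ k : ℤ, (k : ℝ) * ω ∈ A := fun k => by
      simpa using A.zsmul_mem hωA k
    rw [hω] at h2A h2xA
    obtain ⟨m, hm⟩ := AddSubgroup.mem_closure_singleton.1 h2A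
    obtain ⟨n, hn⟩ := AddSubgroup.mem_closure_singleton.1 h2xA
    rw [zsmul_eq_mul] at hm hn
    rcases Int.even_or_odd' m with ⟨k, rfl | rfl⟩
    · refine hone ?_
      convert hmul k using 1
      push_cast at hm; linarith
    rcases Int.even_or_odd' n with ⟨l, rfl | rfl⟩
    · refine hxA ?_
      convert hmul l using 1
      push_cast at hn; linarith
    · refine h1x ?_
      convert hmul (k - l) using 1
      push_cast at hm hn ⊢; linarith

theorem growth_of_omits_ball (hF : Differentiable ℂ F) {c : ℂ} {δ R : ℝ} (hδ : 0 < δ)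
    (h : ∀ z, R < ‖z‖ → δ ≤ ‖F z - c‖) :
    ∃ (C R' : ℝ) (n : ℕ), ∀ z, R' < ‖z‖ → ‖F z‖ ≤ C * ‖z‖ ^ n := by
  wlog hR : 0 < R generalizing R
  · exact this (R := 1) (fun z hz => h z (by linarith)) one_pos
  let g : ℂ → ℂ := fun w => (F w⁻¹ - c)⁻¹
  let s : Set ℂ := Metric.ball 0 R⁻¹
  have hs : s ∈ 𝓝 (0 : ℂ) := Metric.ball_mem_nhds _ (inv_pos.2 hR)
  have hw : ∀ w ∈ s \ {0}, δ ≤ ‖F w⁻¹ - c‖ := by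
    rintro w ⟨hw, hw0⟩
    refine h _ ?_
    rw [norm_inv]
    exact (lt_inv_comm₀ (norm_pos_iff.2 hw0) hR).1 (by simpa [s] using hw)
  have hne : ∀ w ∈ s \ {0}, F w⁻¹ - c ≠ 0 := fun w hw' h0 => by
    have := hw w hw'
    rw [h0, norm_zero] at this
    linarith
  have hd : DifferentiableOn ℂ g (s \ {0}) := fun w hw' => by
    have h1 : DifferentiableAt ℂ (fun w : ℂ => w⁻¹) w := differentiableAt_inv hw'.2
    have h2 : DifferentiableAt ℂ (fun w : ℂ => F w⁻¹) w := (hF _).comp w h1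
    exact ((h2.sub_const c).inv (hne w hw')).differentiableWithinAt
  have hb : BddAbove (norm ∘ g '' (s \ {0})) := by
    refine ⟨δ⁻¹, ?_⟩
    rintro _ ⟨w, hw', rfl⟩
    simp only [Function.comp, g, norm_inv]
    exact inv_anti₀ hδ (hw w hw')
  have hG := Complex.differentiableOn_update_limUnder_of_bddAbove hs hd hb
  set G := Function.update g 0 ((𝓝[≠] 0).limUnder g)
  have hGg : ∀ w, w ≠ 0 → G w = g w := fun w hw => Function.update_of_ne hw _ _
  have hGa : AnalyticAt ℂ G 0 := hG.analyticAt hs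
  have hnz : ¬ ∀ᶠ w in 𝓝 0, G w = 0 := by
    intro h0
    have h1 : ∀ᶠ w in 𝓝[≠] (0 : ℂ), (G w = 0 ∧ w ∈ s) ∧ w ∈ ({0}ᶜ : Set ℂ) :=
      ((h0.and hs).filter_mono nhdsWithin_le_nhds).and self_mem_nhdsWithin
    obtain ⟨w, ⟨hw0, hws⟩, hw1⟩ := h1.exists
    rw [hGg w hw1] at hw0
    exact hne w ⟨hws, hw1⟩ (inv_eq_zero.1 hw0)
  obtain ⟨n, u, hu, hu0, hGu⟩ := hGa.exists_eventuallyEq_pow_smul_nonzero_iff.2 hnz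
  have hm : 0 < ‖u 0‖ / 2 := by positivity
  have hum : ∀ᶠ w in 𝓝 (0 : ℂ), ‖u 0‖ / 2 < ‖u w‖ :=
    continuousAt_const.eventually_lt hu.continuousAt.norm (by linarith)
  obtain ⟨ρ, hρ, hball⟩ := Metric.eventually_nhds_iff.1 (hGu.and hum)
  refine ⟨‖c‖ + (‖u 0‖ / 2)⁻¹, max 1 ρ⁻¹, n, fun z hz => ?_⟩
  have hz1 : 1 < ‖z‖ := (le_max_left _ _).trans_lt hz
  have hz0 : z ≠ 0 := norm_pos_iff.1 (by linarith)
  have hzρ : ‖z⁻¹‖ < ρ := by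
    rw [norm_inv]
    exact (inv_lt_comm₀ hρ (by linarith)).1 ((le_max_right _ _).trans_lt hz)
  obtain ⟨e1, e2⟩ := hball (y := z⁻¹) (by simpa using hzρ)
  rw [hGg _ (inv_ne_zero hz0)] at e1
  simp only [g, inv_inv, sub_zero, smul_eq_mul] at e1
  have e3 : ‖F z - c‖ = ‖z‖ ^ n * ‖u z⁻¹‖⁻¹ := by
    have := congrArg (fun x => ‖x‖⁻¹) e1
    simpa [mul_comm] using this
  have e4 : ‖u z⁻¹‖⁻¹ ≤ (‖u 0‖ / 2)⁻¹ := inv_anti₀ hm e2.le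
  have e5 : 1 ≤ ‖z‖ ^ n := one_le_pow₀ hz1.le
  calc ‖F z‖ = ‖F z - c + c‖ := by rw [sub_add_cancel]
    _ ≤ ‖F z - c‖ + ‖c‖ := norm_add_le _ _
    _ ≤ ‖z‖ ^ n * (‖u 0‖ / 2)⁻¹ + ‖c‖ * ‖z‖ ^ n := by
      rw [e3]
      gcongr
      exact le_mul_of_one_le_right (norm_nonneg c) e5
    _ = _ := by ring

open Polynomial in
theorem exists_polynomial_of_growth (hF : Differentiable ℂ F) {C R : ℝ} {n : ℕ}
    (h : ∀ z, R < ‖z‖ → ‖F z‖ ≤ C * ‖z‖ ^ n) : ∃ P : ℂ[X], ∀ z, F z = P.eval z := by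
  have hder : ∀ k, n < k → iteratedDeriv k F 0 = 0 := by
    intro k hk
    have hbound : ∀ r : ℝ, max 1 R < r → ‖iteratedDeriv k F 0‖ ≤ k.factorial * C * r⁻¹ := by
      intro r hr
      have hr1 : 1 < r := (le_max_left _ _).trans_lt hr
      have hrR : R < r := (le_max_right _ _).trans_lt hr
      have hr0 : 0 < r := by linarith
      have hC : 0 ≤ C := by
        have := (norm_nonneg _).trans (h (r : ℂ) (by simpa [abs_of_pos hr0] using hrR))
        refine nonneg_of_mul_nonneg_left this ?_
        simp only [Complex.norm_real, Real.norm_eq_abs, abs_of_pos hr0]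
        positivity
      have := Complex.norm_iteratedDeriv_le_of_forall_mem_sphere_norm_le (c := 0) (C := C * r ^ n)
        k hr0 hF.diffContOnCl (fun z hz => by
          have hz' : ‖z‖ = r := by simpa using hz
          rw [← hz']; exact h z (hz' ▸ hrR))
      refine this.trans ?_
      rw [div_le_iff₀ (by positivity)]
      have h2 : r ^ n * r ≤ r ^ k := by
        rw [← pow_succ]; exact pow_le_pow_right₀ hr1.le hk
      have h3 : (k.factorial : ℝ) * C * r⁻¹ * (r ^ n * r) ≤ k.factorial * C * r⁻¹ * r ^ k := by
        gcongr
      refine le_trans (le_of_eq ?_) h3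
      field_simp
    have hlim : Filter.Tendsto (fun r : ℝ => (k.factorial * C) * r⁻¹) Filter.atTop (𝓝 0) := by
      simpa using tendsto_inv_atTop_zero.const_mul ((k.factorial : ℝ) * C)
    have := ge_of_tendsto hlim ((Filter.eventually_gt_atTop (max 1 R)).mono hbound)
    exact norm_le_zero_iff.1 this
  refine ⟨∑ k ∈ Finset.range (n + 1), Polynomial.monomial k ((k.factorial : ℂ)⁻¹ * iteratedDeriv k F 0),
    fun z => ?_⟩
  have h1 := Complex.taylorSeries_eq_of_entire' (c := 0) (z := z) hF
  rw [tsum_eq_sum (s := Finset.range (n + 1))] at h1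
  · rw [← h1, Polynomial.eval_finsetSum]
    simp
  · intro k hk
    rw [hder k (by simpa using hk)]
    simp

open Polynomial in
theorem natDegree_le_two {P : ℂ[X]}
    (h : ∀ a₁ a₂ a₃ : ℂ, P.derivative.eval a₁ ≠ 0 → P.derivative.eval a₂ ≠ 0 →
      P.derivative.eval a₃ ≠ 0 → a₁ ≠ a₂ → a₁ ≠ a₃ → a₂ ≠ a₃ → P.eval a₂ = P.eval a₁ →
      P.eval a₃ = P.eval a₁ → False) : P.natDegree ≤ 2 := by
  by_contra! hdeg
  have hP' : P.derivative ≠ 0 := fun h0 => by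
    have := derivative_eq_zero.1 h0
    omega
  obtain ⟨c, hc⟩ := ((P.derivative.roots.toFinset.image fun x => P.eval x)).exists_notMem
  have hc' : ∀ a, P.eval a = c → P.derivative.eval a ≠ 0 := by
    intro a ha h0
    refine hc (Finset.mem_image.2 ⟨a, ?_, ha⟩)
    rw [Multiset.mem_toFinset, mem_roots hP']
    exact h0
  have hsep : (P - C c).Separable := by
    rw [Polynomial.Separable, Polynomial.isCoprime_iff_aeval_ne_zero_of_isAlgClosed (k := ℂ) (K := ℂ)]
    intro a
    by_cases ha : P.eval a = c
    · right; simpa using hc' a ha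
    · left; simpa [sub_eq_zero] using ha
  have hcard : 2 < (P - C c).roots.toFinset.card := by
    rw [Multiset.toFinset_card_of_nodup (nodup_roots hsep), IsAlgClosed.card_roots_eq_natDegree,
      natDegree_sub_C]
    exact hdeg
  have hroot : ∀ a ∈ (P - C c).roots.toFinset, P.eval a = c := by
    intro a ha
    have := isRoot_of_mem_roots (Multiset.mem_toFinset.1 ha)
    simpa [sub_eq_zero] using this
  obtain ⟨a₁, h₁, a₂, h₂, a₃, h₃, h₁₂, h₁₃, h₂₃⟩ := Finset.two_lt_card.1 hcard
  exact h a₁ a₂ a₃ (hc' _ (hroot _ h₁)) (hc' _ (hroot _ h₂)) (hc' _ (hroot _ h₃)) h₁₂ h₁₃ h₂₃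
    ((hroot _ h₂).trans (hroot _ h₁).symm) ((hroot _ h₃).trans (hroot _ h₁).symm)

/-- If an entire function omits an open set of values at its noncritical points outside of a
bounded set, then it is a polynomial. -/
theorem exists_polynomial_of_omits (hf : Differentiable ℂ f) (hF : ∀ w, HasDerivAt F (f w) w)
    (ha : f a ≠ 0) {B W : Set ℂ} (hB : Bornology.IsBounded B) (hW : IsOpen W) (hWn : W.Nonempty)
    (h : ∀ z ∉ B, F z ∈ W → f z = 0) : ∃ P : Polynomial ℂ, ∀ z, F z = P.eval z := by
  have hFd : Differentiable ℂ F := fun w => (hF w).differentiableAt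
  obtain ⟨R, hR⟩ := hB.subset_closedBall 0
  obtain ⟨c, hc⟩ := hWn
  obtain ⟨δ, hδ, hball⟩ := Metric.isOpen_iff.1 hW c hc
  have key : ∀ z, R < ‖z‖ → F z ∉ W := by
    intro z hz hzW
    have hev : ∀ᶠ w in 𝓝 z, f w = 0 := by
      have h1 : ∀ᶠ w in 𝓝 z, R < ‖w‖ :=
        continuousAt_const.eventually_lt continuous_norm.continuousAt hz
      have h2 : ∀ᶠ w in 𝓝 z, F w ∈ W := hFd.continuous.continuousAt (hW.mem_nhds hzW)
      filter_upwards [h1, h2] with w hw1 hw2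
      refine h w (fun hwB => ?_) hw2
      have := hR hwB
      rw [mem_closedBall_zero_iff] at this
      linarith
    have := AnalyticOnNhd.eqOn_zero_of_preconnected_of_eventuallyEq_zero (U := univ)
      (fun w _ => hf.analyticAt w) isPreconnected_univ (mem_univ z) hev
    exact ha (this (mem_univ a))
  obtain ⟨C, R', n, hgrow⟩ := growth_of_omits_ball hFd (c := c) hδ (R := R) fun z hz => by
    by_contra! hlt
    exact key z hz (hball (by simpa [dist_eq_norm] using hlt))
  exact exists_polynomial_of_growth hFd hgrow

/-- If `z'' = f z` has entire solutions for all initial data, then `f` is affine. -/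
theorem exists_affine_of_complete (hf : Differentiable ℂ f)
    (hcomp : ∀ z₀ v₀, ∃ z v, IsSol f z v ∧ z 0 = z₀ ∧ v 0 = v₀) :
    ∃ α β : ℂ, ∀ w, f w = α * w + β := by
  obtain ⟨F, hF'⟩ := hf.isExactOn_univ
  have hF : ∀ w, HasDerivAt F (f w) w := fun w => hF' w (mem_univ w)
  have hFd : Differentiable ℂ F := fun w => (hF w).differentiableAt
  by_cases h0 : ∀ w, f w = 0
  · exact ⟨0, 0, fun w => by simp [h0 w]⟩
  push Not at h0
  obtain ⟨a, ha⟩ := h0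
  have hFopen : IsOpenMap F := by
    refine (AnalyticOnNhd.is_constant_or_isOpenMap
      (fun t _ => hFd.analyticAt t)).resolve_left ?_
    rintro ⟨w, hw⟩
    have : HasDerivAt F 0 a := by
      rw [show F = fun _ => w from funext hw]; exact hasDerivAt_const a w
    exact ha ((hF a).unique this)
  have hP : ∃ P : Polynomial ℂ, ∀ z, F z = P.eval z := by
    by_cases hinj : ∃ b₁ b₂, b₁ ≠ b₂ ∧ F b₁ = F b₂ ∧ f b₁ ≠ 0 ∧ f b₂ ≠ 0
    · obtain ⟨b₁, b₂, hb, hFb, h₁, h₂⟩ := hinj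
      obtain ⟨U₁, U₂, hU₁, hU₂, hm₁, hm₂, hdisj⟩ := t2_separation hb
      have hO : IsOpen {w | f w ≠ 0} := isOpen_ne_fun hf.continuous continuous_const
      let B₁ := Metric.ball b₁ 1 ∩ U₁ ∩ {w | f w ≠ 0}
      let B₂ := Metric.ball b₂ 1 ∩ U₂ ∩ {w | f w ≠ 0}
      have hB₁ : IsOpen B₁ := (Metric.isOpen_ball.inter hU₁).inter hO
      have hB₂ : IsOpen B₂ := (Metric.isOpen_ball.inter hU₂).inter hO
      refine exists_polynomial_of_omits hf hF ha (B := B₁ ∪ B₂) (W := F '' B₁ ∩ F '' B₂) ?_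
        ((hFopen _ hB₁).inter (hFopen _ hB₂))
        ⟨F b₁, ⟨b₁, ⟨⟨Metric.mem_ball_self one_pos, hm₁⟩, h₁⟩, rfl⟩,
          ⟨b₂, ⟨⟨Metric.mem_ball_self one_pos, hm₂⟩, h₂⟩, hFb.symm⟩⟩ ?_
      · exact (Metric.isBounded_ball.subset (inter_subset_left.trans inter_subset_left)).union
          (Metric.isBounded_ball.subset (inter_subset_left.trans inter_subset_left))
      · rintro z hz ⟨⟨w₁, hw₁, e₁⟩, ⟨w₂, hw₂, e₂⟩⟩
        by_contra hfz
        refine no_three_on_level hf hF hcomp hfz hw₁.2 hw₂.2 ?_ ?_ ?_ e₁ e₂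
        · rintro rfl; exact hz (Or.inl hw₁)
        · rintro rfl; exact hz (Or.inr hw₂)
        · rintro rfl; exact hdisj.le_bot ⟨hw₁.1.2, hw₂.1.2⟩
    · push Not at hinj
      have hO : IsOpen {w | f w ≠ 0} := isOpen_ne_fun hf.continuous continuous_const
      let B := Metric.ball a 1 ∩ {w | f w ≠ 0}
      refine exists_polynomial_of_omits hf hF ha (B := B) (W := F '' B)
        (Metric.isBounded_ball.subset inter_subset_left)
        (hFopen _ (Metric.isOpen_ball.inter hO)) ⟨F a, a, ⟨Metric.mem_ball_self one_pos, ha⟩, rfl⟩ ?_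
      rintro z hz ⟨w, hw, e⟩
      exact hinj w z (fun h => hz (h ▸ hw)) e hw.2
  obtain ⟨P, hP⟩ := hP
  have hfP : ∀ w, f w = P.derivative.eval w := by
    intro w
    have := hF w
    rw [show F = fun z => P.eval z from funext hP] at this
    exact this.unique (P.hasDerivAt w)
  have hdeg : P.natDegree ≤ 2 := natDegree_le_two fun a₁ a₂ a₃ h₁ h₂ h₃ h₁₂ h₁₃ h₂₃ e₂ e₃ => by
    rw [← hfP] at h₁ h₂ h₃
    rw [← hP, ← hP] at e₂ e₃
    exact no_three_on_level hf hF hcomp h₁ h₂ h₃ h₁₂ h₁₃ h₂₃ e₂ e₃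
  have hdeg' : P.derivative.natDegree ≤ 1 := (Polynomial.natDegree_derivative_le P).trans (by omega)
  refine ⟨P.derivative.coeff 1, P.derivative.coeff 0, fun w => ?_⟩
  conv_lhs => rw [hfP, Polynomial.eq_X_add_C_of_natDegree_le_one hdeg']
  simp

end SecondOrder

section Planar

theorem add_mul_sub_mem {s : Set ℝ} (hs : s.OrdConnected) {t₀ t l : ℝ} (h₀ : t₀ ∈ s) (h : t ∈ s)
    (hl : l ∈ Icc (0 : ℝ) 1) : t₀ + l * (t - t₀) ∈ s :=
  hs.convex.add_smul_sub_mem h₀ h hl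

open Complex (equivRealProdCLM)

variable {F : ℝ × ℝ → ℝ × ℝ} {f : ℂ → ℂ} {q v : ℝ → ℝ × ℝ} {s : Set ℝ} {t : ℝ}

/-- The curve in the complex phase space given by a real planar curve and its velocity. -/
def phaseCurve (q v : ℝ → ℝ × ℝ) (t : ℝ) : ℂ × ℂ :=
  (equivRealProdCLM.symm (q t), equivRealProdCLM.symm (v t))

theorem hasDerivAt_phaseCurve
    (hFf : ∀ w, f w = equivRealProdCLM.symm (F (equivRealProdCLM w)))
    (h : SolOn F q v s) (ht : t ∈ s) :
    HasDerivAt (phaseCurve q v) (phaseField f (phaseCurve q v t)) t := by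
  obtain ⟨h1, h2⟩ := h t ht
  have h3 := equivRealProdCLM.symm.hasFDerivAt.comp_hasDerivAt t h1
  have h4 := equivRealProdCLM.symm.hasFDerivAt.comp_hasDerivAt t h2
  have h5 := h3.prodMk h4
  simp only [phaseField, phaseCurve, hFf, ContinuousLinearEquiv.apply_symm_apply]
  exact h5

theorem isRay_phaseCurve (hFf : ∀ w, f w = equivRealProdCLM.symm (F (equivRealProdCLM w)))
    (h : SolOn F q v s) (hs : s.OrdConnected) {t₀ : ℝ} (ht₀ : t₀ ∈ s) (ht : t ∈ s) :
    IsRay (phaseField f) ((t - t₀ : ℝ) : ℂ) (phaseCurve q v t₀)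
      (fun l : ℝ => phaseCurve q v (t₀ + l * (t - t₀))) :=
  isRay_of_hasDerivAt_segment fun _ hl =>
    hasDerivAt_phaseCurve hFf h (add_mul_sub_mem hs ht₀ ht hl)

theorem solOn_of_hasDerivAt (hFf : ∀ w, f w = equivRealProdCLM.symm (F (equivRealProdCLM w)))
    {x y : ℝ → ℂ} (h : ∀ t ∈ s, HasDerivAt x (y t) t ∧ HasDerivAt y (f (x t)) t) :
    SolOn F (fun t => equivRealProdCLM (x t)) (fun t => equivRealProdCLM (y t)) s := by
  intro t ht
  obtain ⟨h1, h2⟩ := h t ht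
  rw [hFf] at h2
  refine ⟨equivRealProdCLM.hasFDerivAt.comp_hasDerivAt t h1, ?_⟩
  have := equivRealProdCLM.hasFDerivAt.comp_hasDerivAt t h2
  simp only [ContinuousLinearEquiv.coe_coe, ContinuousLinearEquiv.apply_symm_apply] at this
  exact this

theorem exists_affine_of_forall_isMaximalSolution (hf : Differentiable ℂ f)
    (hFf : ∀ w, f w = equivRealProdCLM.symm (F (equivRealProdCLM w)))
    (h : ∀ q v s, IsMaximalSolution F q v s → s = univ) : ∃ α β : ℂ, ∀ w, f w = α * w + β := by
  have hX := contDiff_phaseField hf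
  have hreal : ∀ (a : ℝ) (p : ℂ × ℂ), ((a : ℂ), p) ∈ flowDomain (phaseField f) := by
    intro a p
    let s : Set ℝ := {t | ((t : ℂ), p) ∈ flowDomain (phaseField f)}
    let Z : ℝ → ℂ × ℂ := fun t => flow (phaseField f) ((t : ℂ), p)
    have h0 : (0 : ℝ) ∈ s := by simpa [s] using zero_mem_flowDomain
    have hZ0 : Z 0 = p := by simpa [Z] using flow_zero hX
    suffices s = univ from (this ▸ mem_univ a : a ∈ s)
    refine h (fun t => equivRealProdCLM (Z t).1) (fun t => equivRealProdCLM (Z t).2) s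
      ⟨?_, ?_, ⟨0, h0⟩, ?_, ?_⟩
    · exact (isOpen_flowDomain hX).preimage (by fun_prop)
    · refine StarConvex.ordConnected (x := 0) h0 ?_
      intro t ht a b _ hb hab
      have := flowDomain_scale ht (l := b) ⟨hb, by linarith⟩
      simpa [s] using this
    · refine solOn_of_hasDerivAt hFf fun t ht => ?_
      have h1 := hasDerivAt_flow hX ht
      have h2 := (hasFDerivAt_fst (𝕜 := ℂ)).comp_hasDerivAt (t : ℂ) h1
      have h3 := (hasFDerivAt_snd (𝕜 := ℂ)).comp_hasDerivAt (t : ℂ) h1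
      exact ⟨hasDerivAt_ofReal h2, hasDerivAt_ofReal h3⟩
    · intro s' q' v' _ hs' hss' hsol hext
      refine (Subset.antisymm hss' fun t ht => ?_).symm
      have hr := isRay_phaseCurve hFf hsol hs' (hss' h0) ht
      have hp : phaseCurve q' v' 0 = p := by
        rw [phaseCurve, (hext 0 h0).1, (hext 0 h0).2]
        simp only [hZ0, ContinuousLinearEquiv.symm_apply_apply]
      rw [hp, sub_zero] at hr
      exact hr.mem
  have huniv := flowDomain_eq_univ hX hreal
  refine exists_affine_of_complete hf fun z₀ v₀ => ?_
  have hd : ∀ c : ℂ, HasDerivAt (fun c => flow (phaseField f) (c, (z₀, v₀)))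
      (phaseField f (flow (phaseField f) (c, (z₀, v₀)))) c := fun c =>
    hasDerivAt_flow hX (huniv ▸ mem_univ _)
  refine ⟨fun c => (flow (phaseField f) (c, (z₀, v₀))).1,
    fun c => (flow (phaseField f) (c, (z₀, v₀))).2, ⟨fun c => ?_, fun c => ?_⟩, ?_, ?_⟩
  · exact hasFDerivAt_fst.comp_hasDerivAt c (hd c)
  · exact hasFDerivAt_snd.comp_hasDerivAt c (hd c)
  · simp [flow_zero hX]
  · simp [flow_zero hX]

theorem exists_sol_of_affine (α β x₀ y₀ : ℂ) (t₀ : ℝ) :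
    ∃ x y : ℝ → ℂ, (∀ t, HasDerivAt x (y t) t ∧ HasDerivAt y (α * x t + β) t) ∧
      x t₀ = x₀ ∧ y t₀ = y₀ := by
  suffices ∃ x y : ℂ → ℂ, (∀ t, HasDerivAt x (y t) t ∧ HasDerivAt y (α * x t + β) t) ∧
      x t₀ = x₀ ∧ y t₀ = y₀ by
    obtain ⟨x, y, h, h1, h2⟩ := this
    exact ⟨fun t => x t, fun t => y t,
      fun t => ⟨hasDerivAt_ofReal (h t).1, hasDerivAt_ofReal (h t).2⟩, h1, h2⟩
  obtain ⟨k, rfl⟩ : ∃ k, α = k ^ 2 := by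
    obtain ⟨k, hk⟩ := IsAlgClosed.exists_pow_nat_eq α two_pos
    exact ⟨k, hk.symm⟩
  by_cases hk : k = 0
  · subst hk
    refine ⟨fun t => x₀ + y₀ * (t - t₀) + β * (t - t₀) ^ 2 / 2, fun t => y₀ + β * (t - t₀),
      fun t => ⟨?_, ?_⟩, by simp, by simp⟩
    · have h := (hasDerivAt_id t).sub_const (t₀ : ℂ)
      have h2 := ((h.const_mul y₀).const_add x₀).add (((h.pow 2).const_mul β).div_const 2)
      convert! h2 using 1
      simp; ring
    · have h := (((hasDerivAt_id t).sub_const (t₀ : ℂ)).const_mul β).const_add y₀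
      convert! h using 1
      simp
  · have he : ∀ (c t : ℂ), HasDerivAt (fun t : ℂ => Complex.exp (c * (t - t₀)))
        (c * Complex.exp (c * (t - t₀))) t := by
      intro c t
      have := (((hasDerivAt_id t).sub_const (t₀ : ℂ)).const_mul c).cexp
      convert! this using 1
      simp; ring
    let A : ℂ := (x₀ + β / k ^ 2 + y₀ / k) / 2
    let B : ℂ := (x₀ + β / k ^ 2 - y₀ / k) / 2
    refine ⟨fun t => A * Complex.exp (k * (t - t₀)) + B * Complex.exp (-k * (t - t₀)) - β / k ^ 2,
      fun t => k * A * Complex.exp (k * (t - t₀)) - k * B * Complex.exp (-k * (t - t₀)),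
      fun t => ⟨?_, ?_⟩, ?_, ?_⟩
    · have := (((he k t).const_mul A).add ((he (-k) t).const_mul B)).sub_const (β / k ^ 2)
      convert! this using 1
      ring
    · have := ((he k t).const_mul (k * A)).sub ((he (-k) t).const_mul (k * B))
      convert! this using 1
      field_simp
      ring
    · simp [A, B]; ring
    · simp [A, B]; field_simp; ring

theorem eq_univ_of_affine
    (hFf : ∀ w, f w = equivRealProdCLM.symm (F (equivRealProdCLM w))) {α β : ℂ}
    (hf : ∀ w, f w = α * w + β) (h : IsMaximalSolution F q v s) : s = univ := by
  obtain ⟨-, hs, ⟨t₀, ht₀⟩, hsol, hmax⟩ := h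
  have hfd : Differentiable ℂ f := by
    rw [funext hf]; fun_prop
  obtain ⟨x, y, hxy, hx, hy⟩ := exists_sol_of_affine α β (equivRealProdCLM.symm (q t₀))
    (equivRealProdCLM.symm (v t₀)) t₀
  have hsol' : SolOn F (fun t => equivRealProdCLM (x t)) (fun t => equivRealProdCLM (y t)) univ :=
    solOn_of_hasDerivAt hFf fun t _ => by rw [hf]; exact hxy t
  refine (hmax univ _ _ isOpen_univ ordConnected_univ (subset_univ s) hsol' fun t ht => ?_).symm
  have r₁ := isRay_phaseCurve hFf hsol hs ht₀ ht
  have r₂ := isRay_phaseCurve hFf hsol' ordConnected_univ (mem_univ t₀) (mem_univ t)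
  have hp : phaseCurve (fun t => equivRealProdCLM (x t)) (fun t => equivRealProdCLM (y t)) t₀ =
      phaseCurve q v t₀ := by simp [phaseCurve, hx, hy]
  rw [hp] at r₂
  have := r₂.eqOn (contDiff_phaseField hfd) r₁ (right_mem_Icc.2 zero_le_one)
  simp only [phaseCurve, one_mul, add_sub_cancel, Prod.mk.injEq,
    ContinuousLinearEquiv.symm_apply_apply] at this
  rw [this.1, this.2]
  simp

open InnerProductSpace in
theorem differentiable_complexGradient {V : ℝ × ℝ → ℝ} (hC2 : ContDiff ℝ 2 V)
    (hharm : ∀ p : ℝ × ℝ, fderiv ℝ (fun q => fderiv ℝ V q (1, 0)) p (1, 0)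
        + fderiv ℝ (fun q => fderiv ℝ V q (0, 1)) p (0, 1) = 0) :
    Differentiable ℂ fun z : ℂ => equivRealProdCLM.symm
      (-(fderiv ℝ V (equivRealProdCLM z) (1, 0)), fderiv ℝ V (equivRealProdCLM z) (0, 1)) := by
  let g : ℂ → ℝ := V ∘ equivRealProdCLM
  have hg : ContDiff ℝ 2 g := hC2.comp equivRealProdCLM.contDiff
  have h1 : ∀ z w, fderiv ℝ g z w = fderiv ℝ V (equivRealProdCLM z) (equivRealProdCLM w) := by
    intro z w
    rw [equivRealProdCLM.comp_right_fderiv]; rfl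
  have h2 : ∀ z w, iteratedFDeriv ℝ 2 g z ![w, w] =
      fderiv ℝ (fun q => fderiv ℝ V q (equivRealProdCLM w)) (equivRealProdCLM z)
        (equivRealProdCLM w) := by
    intro z w
    have hd : DifferentiableAt ℝ (fderiv ℝ g) z :=
      ((hg.fderiv_right (m := 1) le_rfl).differentiable one_ne_zero) z
    have e1 : fderiv ℝ (fun z => fderiv ℝ g z w) z w = fderiv ℝ (fderiv ℝ g) z w w := by
      rw [fderiv_clm_apply hd (differentiableAt_const w)]
      simp
    have e2 : (fun z => fderiv ℝ g z w) =
        (fun q => fderiv ℝ V q (equivRealProdCLM w)) ∘ equivRealProdCLM :=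
      funext fun z => h1 z w
    rw [e2, equivRealProdCLM.comp_right_fderiv] at e1
    rw [iteratedFDeriv_two_apply]
    exact e1.symm
  have hone : equivRealProdCLM 1 = ((1 : ℝ), (0 : ℝ)) := rfl
  have hI : equivRealProdCLM Complex.I = ((0 : ℝ), (1 : ℝ)) := rfl
  have hgharm : ∀ z, HarmonicAt g z := fun z => by
    refine ⟨hg.contDiffAt, Filter.Eventually.of_forall fun w => ?_⟩
    rw [laplacian_eq_iteratedFDeriv_complexPlane]
    simp only [h2, hone, hI, hharm, Pi.zero_apply]
  have key : Differentiable ℂ fun z => -((fderiv ℝ g z 1 : ℂ) - Complex.I * fderiv ℝ g z Complex.I) :=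
    fun z => (HarmonicAt.differentiableAt_complex_partial (hgharm z)).neg
  convert! key using 2 with z
  rw [h1, h1, hone, hI, Complex.equivRealProdCLM_symm_apply]
  push_cast
  ring

/-- The quadratic polynomial function on the plane with the given coefficients. -/
def quadratic (a b c d e g : ℝ) (p : ℝ × ℝ) : ℝ :=
  a + b * p.1 + c * p.2 + d * p.1 ^ 2 + e * (p.1 * p.2) + g * p.2 ^ 2

theorem hasFDerivAt_quadratic (a b c d e g : ℝ) (p : ℝ × ℝ) :
    HasFDerivAt (quadratic a b c d e g)
      ((b + 2 * d * p.1 + e * p.2) • ContinuousLinearMap.fst ℝ ℝ ℝ +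
        (c + e * p.1 + 2 * g * p.2) • ContinuousLinearMap.snd ℝ ℝ ℝ) p := by
  have hx : HasFDerivAt Prod.fst (ContinuousLinearMap.fst ℝ ℝ ℝ) p := hasFDerivAt_fst
  have hy : HasFDerivAt Prod.snd (ContinuousLinearMap.snd ℝ ℝ ℝ) p := hasFDerivAt_snd
  have := (((((hx.const_mul b).const_add a).add (hy.const_mul c)).add
    ((hx.pow 2).const_mul d)).add ((hx.mul hy).const_mul e)).add ((hy.pow 2).const_mul g)
  convert! this using 1
  ext <;> simp <;> ring

theorem exists_eval_eq_quadratic {P : MvPolynomial (Fin 2) ℝ} (hP : P.totalDegree ≤ 2) :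
    ∃ a b c d e g : ℝ, ∀ p : ℝ × ℝ,
      MvPolynomial.eval ![p.1, p.2] P = quadratic a b c d e g p := by
  simp only [MvPolynomial.eval_eq']
  have key : ∀ m ∈ P.support, ∃ a b c d e g : ℝ, ∀ p : ℝ × ℝ,
      P.coeff m * ∏ i, ![p.1, p.2] i ^ m i = quadratic a b c d e g p := by
    intro m hm
    have hm' : m 0 + m 1 ≤ 2 := by
      have := (MvPolynomial.le_totalDegree hm).trans hP
      rwa [Finsupp.sum_fintype _ _ (fun _ => rfl), Fin.sum_univ_two] at this
    simp only [Fin.prod_univ_two, Matrix.cons_val_zero, Matrix.cons_val_one]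
    generalize P.coeff m = k
    generalize m 0 = i at *
    generalize m 1 = j at *
    have hi : i ≤ 2 := by omega
    have hj : j ≤ 2 := by omega
    interval_cases i <;> interval_cases j <;> try omega
    · exact ⟨k, 0, 0, 0, 0, 0, fun p => by simp [quadratic]⟩
    · exact ⟨0, 0, k, 0, 0, 0, fun p => by simp [quadratic]⟩
    · exact ⟨0, 0, 0, 0, 0, k, fun p => by simp [quadratic]⟩
    · exact ⟨0, k, 0, 0, 0, 0, fun p => by simp [quadratic]⟩
    · exact ⟨0, 0, 0, 0, k, 0, fun p => by simp [quadratic]⟩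
    · exact ⟨0, 0, 0, k, 0, 0, fun p => by simp [quadratic]⟩
  choose! a b c d e g h using key
  refine ⟨∑ m ∈ P.support, a m, ∑ m ∈ P.support, b m, ∑ m ∈ P.support, c m, ∑ m ∈ P.support, d m,
    ∑ m ∈ P.support, e m, ∑ m ∈ P.support, g m, fun p => ?_⟩
  rw [Finset.sum_congr rfl fun m hm => h m hm p]
  simp only [quadratic, Finset.sum_add_distrib, Finset.sum_mul]

open MvPolynomial in
theorem exists_mvPolynomial_eq_quadratic (a b c d e g : ℝ) :
    ∃ P : MvPolynomial (Fin 2) ℝ, P.totalDegree ≤ 2 ∧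
      ∀ p : ℝ × ℝ, quadratic a b c d e g p = MvPolynomial.eval ![p.1, p.2] P := by
  refine ⟨C a + C b * X 0 + C c * X 1 + C d * X 0 ^ 2 + C e * (X 0 * X 1) + C g * X 1 ^ 2, ?_,
    fun p => by simp [quadratic]⟩
  have hX : ∀ i : Fin 2, (X i : MvPolynomial (Fin 2) ℝ).totalDegree ≤ 1 := fun i => by
    rw [totalDegree_X]
  have hC : ∀ (k : ℝ) (Q : MvPolynomial (Fin 2) ℝ), Q.totalDegree ≤ 2 →
      (C k * Q).totalDegree ≤ 2 := fun k Q hQ => by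
    refine (totalDegree_mul _ _).trans ?_
    rwa [totalDegree_C, zero_add]
  have hA : ∀ Q R : MvPolynomial (Fin 2) ℝ, Q.totalDegree ≤ 2 → R.totalDegree ≤ 2 →
      (Q + R).totalDegree ≤ 2 := fun Q R hQ hR => (totalDegree_add Q R).trans (max_le hQ hR)
  have hM : ∀ i j : Fin 2, (X i * X j : MvPolynomial (Fin 2) ℝ).totalDegree ≤ 2 := fun i j =>
    (totalDegree_mul _ _).trans (add_le_add (hX i) (hX j))
  have h1 : ∀ i : Fin 2, (X i : MvPolynomial (Fin 2) ℝ).totalDegree ≤ 2 := fun i =>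
    (hX i).trans one_le_two
  refine hA _ _ (hA _ _ (hA _ _ (hA _ _ (hA _ _ (by simp) (hC _ _ (h1 0))) (hC _ _ (h1 1)))
    (hC _ _ ?_)) (hC _ _ (hM 0 1))) (hC _ _ ?_)
  · rw [pow_two]; exact hM 0 0
  · rw [pow_two]; exact hM 1 1

theorem exists_affine_of_harmonic_quadratic {V : ℝ × ℝ → ℝ} {a b c d e g : ℝ}
    (hV : ∀ p, V p = quadratic a b c d e g p)
    (hharm : ∀ p : ℝ × ℝ, fderiv ℝ (fun q => fderiv ℝ V q (1, 0)) p (1, 0)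
        + fderiv ℝ (fun q => fderiv ℝ V q (0, 1)) p (0, 1) = 0) :
    ∃ α β : ℂ, ∀ w : ℂ, equivRealProdCLM.symm
      (-(fderiv ℝ V (equivRealProdCLM w) (1, 0)), fderiv ℝ V (equivRealProdCLM w) (0, 1)) =
        α * w + β := by
  obtain rfl : V = quadratic a b c d e g := funext hV
  have h1 : ∀ p, fderiv ℝ (quadratic a b c d e g) p (1, 0) = quadratic b (2 * d) e 0 0 0 p := by
    intro p
    rw [(hasFDerivAt_quadratic a b c d e g p).fderiv]; simp [quadratic]
  have h2 : ∀ p, fderiv ℝ (quadratic a b c d e g) p (0, 1) = quadratic c e (2 * g) 0 0 0 p := by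
    intro p
    rw [(hasFDerivAt_quadratic a b c d e g p).fderiv]; simp [quadratic]
  simp only [h1, h2] at hharm ⊢
  have hdg := hharm 0
  rw [(hasFDerivAt_quadratic _ _ _ _ _ _ _).fderiv,
    (hasFDerivAt_quadratic _ _ _ _ _ _ _).fderiv] at hdg
  obtain rfl : g = -d := by
    simp at hdg; linarith
  refine ⟨⟨-2 * d, e⟩, ⟨-b, c⟩, fun w => ?_⟩
  apply Complex.ext <;> simp [quadratic] <;> ring

theorem exists_quadratic_of_affine {V : ℝ × ℝ → ℝ} (hV : Differentiable ℝ V) {α β : ℂ}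
    (h : ∀ w : ℂ, equivRealProdCLM.symm
      (-(fderiv ℝ V (equivRealProdCLM w) (1, 0)), fderiv ℝ V (equivRealProdCLM w) (0, 1)) =
        α * w + β) :
    ∃ a b c d e g : ℝ, ∀ p, V p = quadratic a b c d e g p := by
  let Q := quadratic (V 0) (-β.re) β.im (-α.re / 2) α.im (α.re / 2)
  have hd : ∀ p, HasFDerivAt (fun p => V p - Q p) (0 : ℝ × ℝ →L[ℝ] ℝ) p := by
    intro p
    have h1 := (hV p).hasFDerivAt.sub
      (hasFDerivAt_quadratic (V 0) (-β.re) β.im (-α.re / 2) α.im (α.re / 2) p)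
    convert! h1 using 1
    have h2 := h ⟨p.1, p.2⟩
    have hre := congrArg Complex.re h2
    have him := congrArg Complex.im h2
    simp at hre him
    ext
    · simp; linarith
    · simp; linarith
  refine ⟨V 0, -β.re, β.im, -α.re / 2, α.im, α.re / 2, fun p => ?_⟩
  have := is_const_of_fderiv_eq_zero (𝕜 := ℝ) (fun p => (hd p).differentiableAt)
    (fun p => (hd p).fderiv) p 0
  have h0 : Q 0 = V 0 := by simp [Q, quadratic]
  simp only [h0, sub_self] at this
  exact sub_eq_zero.1 this

end Planar

end HolomorphicFlow

open HolomorphicFlow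
open Complex (equivRealProdCLM)

/-- **The holomorphic analogue of the Ehlers–Kundt system (via Forstnerič).**
For a harmonic `V : ℝ² → ℝ`, every maximal solution of the system
`ẍ = -V_x(x,y)`, `ÿ = +V_y(x,y)` is defined on all of `ℝ` if and only if
`V` is a polynomial of degree at most `2`. -/
theorem forstneric_system_complete_iff_quadratic (V : ℝ × ℝ → ℝ)
    (hC2 : ContDiff ℝ 2 V)
    (hharm : ∀ p : ℝ × ℝ,
      fderiv ℝ (fun q => fderiv ℝ V q (1, 0)) p (1, 0)
        + fderiv ℝ (fun q => fderiv ℝ V q (0, 1)) p (0, 1) = 0) :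
    (∀ (q v : ℝ → ℝ × ℝ) (s : Set ℝ),
        IsMaximalSolution
          (fun p => (-(fderiv ℝ V p (1, 0)), fderiv ℝ V p (0, 1))) q v s →
        s = univ)
      ↔ ∃ P : MvPolynomial (Fin 2) ℝ, P.totalDegree ≤ 2 ∧
          ∀ p : ℝ × ℝ, V p = MvPolynomial.eval ![p.1, p.2] P := by
  have hFf : ∀ w : ℂ, equivRealProdCLM.symm
      (-(fderiv ℝ V (equivRealProdCLM w) (1, 0)), fderiv ℝ V (equivRealProdCLM w) (0, 1)) =
      equivRealProdCLM.symm ((fun p : ℝ × ℝ => (-(fderiv ℝ V p (1, 0)), fderiv ℝ V p (0, 1)))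
        (equivRealProdCLM w)) := fun _ => rfl
  constructor
  · intro h
    obtain ⟨α, β, hαβ⟩ := exists_affine_of_forall_isMaximalSolution
      (differentiable_complexGradient hC2 hharm) hFf h
    obtain ⟨a, b, c, d, e, g, hV⟩ :=
      exists_quadratic_of_affine (hC2.differentiable two_ne_zero) hαβ
    obtain ⟨P, hP, hPe⟩ := exists_mvPolynomial_eq_quadratic a b c d e g
    exact ⟨P, hP, fun p => (hV p).trans (hPe p)⟩
  · rintro ⟨P, hP, hV⟩ q v s hmax
    obtain ⟨a, b, c, d, e, g, hPe⟩ := exists_eval_eq_quadratic hP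
    obtain ⟨α, β, hαβ⟩ :=
      exists_affine_of_harmonic_quadratic (fun p => (hV p).trans (hPe p)) hharm
    exact eq_univ_of_affine hFf hαβ hmax

end
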